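/- arXiv:1307.3975 — 2 statements merged into one kernel-verified Lean document; each statement's English description precedes it below -/
import Mathlib

section
/- There exists a constant c such that the following holds. Let F be a finite field of order q and characteristic p, let m ≥ 1 and d ≥ 0 be integers with q - q/p - 1 ≥ d, and let δ be a real number with 0 ≤ δ ≤ 1/(c(d+1)^2). If f : F^m → F and a family {P_{x,h}} of univariate polynomials over F of degree at most d, indexed by pairs (x,h) ∈ F^m × F^m, satisfy Pr_{x,h,t}[P_{x,h}(t) ≠ f(x + t·h)] ≤ δ (where x, h are uniform in F^m and t is uniform in F), then there exists a function g : F^m → F that is the evaluation of a polynomial of total degree at most d with d(f,g) ≤ 2δ. -/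
namespace LowDegreeTest

open Finset
open scoped BigOperators

section Frequency

variable {α β : Type*} [Fintype α] [Fintype β]

open scoped Classical in
/-- The proportion of elements of a finite type satisfying a predicate. -/
noncomputable def freq (p : α → Prop) : ℝ := 𝔼 a, if p a then (1 : ℝ) else 0

lemma freq_eq_card_div (p : α → Prop) [DecidablePred p] :
    freq p = #{a | p a} / Fintype.card α := by
  classical
  rw [freq, Fintype.expect_eq_sum_div_card, ← Finset.sum_boole]
  congr!

lemma freq_nonneg (p : α → Prop) : 0 ≤ freq p :=
  expect_nonneg fun _ _ ↦ by split_ifs <;> norm_num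

lemma freq_mono {p q : α → Prop} (h : ∀ a, p a → q a) : freq p ≤ freq q :=
  expect_le_expect fun a _ ↦ by
    by_cases hp : p a
    · simp [hp, h a hp]
    · simp only [hp, if_false]; split_ifs <;> norm_num

lemma freq_congr {p q : α → Prop} (h : ∀ a, p a ↔ q a) : freq p = freq q := by
  rw [funext fun a ↦ propext (h a)]

lemma freq_or_le (p q : α → Prop) : freq (fun a ↦ p a ∨ q a) ≤ freq p + freq q := by
  rw [freq, freq, freq, ← expect_add_distrib]
  refine expect_le_expect fun a _ ↦ ?_
  by_cases hp : p a <;> by_cases hq : q a <;> simp [hp, hq]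

lemma freq_exists_le {ι : Type*} (s : Finset ι) (p : ι → α → Prop) :
    freq (fun a ↦ ∃ i ∈ s, p i a) ≤ ∑ i ∈ s, freq (p i) := by
  classical
  induction s using Finset.induction_on with
  | empty => simp [freq]
  | insert i s hi ih =>
    rw [sum_insert hi]
    calc _ = freq (fun a ↦ p i a ∨ ∃ j ∈ s, p j a) := freq_congr fun a ↦ by simp
      _ ≤ _ := (freq_or_le _ _).trans (by gcongr)

lemma freq_exists_le_mul {ι : Type*} (s : Finset ι) (p : ι → α → Prop) {ε : ℝ}
    (h : ∀ i ∈ s, freq (p i) ≤ ε) : freq (fun a ↦ ∃ i ∈ s, p i a) ≤ #s * ε :=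
  (freq_exists_le s p).trans <| by
    simpa using Finset.sum_le_card_nsmul s (fun i ↦ freq (p i)) ε h

lemma exists_not_of_freq_lt_one [Nonempty α] {p : α → Prop} (h : freq p < 1) : ∃ a, ¬ p a := by
  by_contra! hp
  have : freq p = 1 := by simp [freq, hp]
  linarith

lemma freq_comp_of_injective (e : α → α) (he : e.Injective) (p : α → Prop) :
    freq (fun a ↦ p (e a)) = freq p :=
  Fintype.expect_bijective e (Finite.injective_iff_bijective.1 he) _ _ fun _ ↦ rfl

lemma freq_prod (p : α × β → Prop) : freq p = 𝔼 a, freq fun b ↦ p (a, b) := by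
  simp only [freq]
  rw [← univ_product_univ, expect_product]

lemma freq_prod' (p : α × β → Prop) : freq p = 𝔼 b, freq fun a ↦ p (a, b) := by
  rw [freq_prod]
  simp only [freq]
  rw [expect_comm]

lemma freq_fst [Nonempty β] (p : α → Prop) : freq (fun z : α × β ↦ p z.1) = freq p := by
  rw [freq_prod]
  refine expect_congr rfl fun a _ ↦ ?_
  by_cases hp : p a <;> simp [freq, hp]

lemma freq_snd [Nonempty α] (p : β → Prop) : freq (fun z : α × β ↦ p z.2) = freq p := by
  rw [freq_prod]
  simp

lemma freq_mul_le_expect {p : α → Prop} {φ : α → ℝ} {c : ℝ} (hφ : ∀ a, 0 ≤ φ a)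
    (h : ∀ a, p a → c ≤ φ a) : freq p * c ≤ 𝔼 a, φ a := by
  rw [freq, expect_mul]
  refine expect_le_expect fun a _ ↦ ?_
  by_cases hp : p a
  · simpa [hp] using h a hp
  · simpa [hp] using hφ a

lemma expect_card_filter {ι : Type*} (s : Finset ι) (p : ι → α → Prop)
    [∀ a, DecidablePred fun i ↦ p i a] :
    𝔼 a, (#{i ∈ s | p i a} : ℝ) = ∑ i ∈ s, freq (p i) := by
  simp only [freq]
  rw [← expect_sum_comm]
  refine expect_congr rfl fun a _ ↦ ?_
  rw [← Finset.sum_boole]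
  congr!

/-- Some value is taken by a map with frequency at least its collision frequency. -/
lemma exists_freq_ne_le [Nonempty α] {γ : Type*} (v : α → γ) :
    ∃ z, freq (fun a ↦ v a ≠ z) ≤ freq (fun a : α × α ↦ v a.1 ≠ v a.2) := by
  rw [freq_prod']
  obtain ⟨b, -, hb⟩ := exists_le_of_expect_le (s := (univ : Finset α))
    (f := fun b ↦ freq fun a ↦ v a ≠ v b) univ_nonempty le_rfl
  exact ⟨v b, hb⟩

end Frequency

section PairSubstitution

variable {F V : Type*} [Field F] [AddCommGroup V] [Module F V] [Fintype V]

/-- An invertible affine substitution preserves the uniform distribution on pairs of vectors. -/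
lemma freq_pair_affine {a₁ a₂ b₁ b₂ : F} (hdet : a₁ * b₂ - a₂ * b₁ ≠ 0) (x y : V)
    (p : V → V → Prop) :
    freq (fun z : V × V ↦ p (x + a₁ • z.1 + a₂ • z.2) (y + b₁ • z.1 + b₂ • z.2)) =
      freq fun z : V × V ↦ p z.1 z.2 := by
  refine freq_comp_of_injective
    (fun z : V × V ↦ (x + a₁ • z.1 + a₂ • z.2, y + b₁ • z.1 + b₂ • z.2)) ?_
    (fun z ↦ p z.1 z.2)
  rintro ⟨z₁, z₂⟩ ⟨w₁, w₂⟩ h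
  simp only [Prod.mk.injEq, add_assoc, add_right_inj] at h
  obtain ⟨h₁, h₂⟩ := h
  have e₁ : (a₁ * b₂ - a₂ * b₁) • (z₁ - w₁) = 0 := by
    linear_combination (norm := module) b₂ • h₁ - a₂ • h₂
  have e₂ : (a₁ * b₂ - a₂ * b₁) • (z₂ - w₂) = 0 := by
    linear_combination (norm := module) a₁ • h₂ - b₁ • h₁
  rw [smul_eq_zero_iff_right hdet, sub_eq_zero] at e₁ e₂
  rw [e₁, e₂]

lemma freq_pair_affine_single {b₁ b₂ : F} (hb : b₁ ≠ 0 ∨ b₂ ≠ 0) (y : V) (p : V → Prop) :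
    freq (fun z : V × V ↦ p (y + b₁ • z.1 + b₂ • z.2)) = freq p := by
  rcases hb with hb | hb
  · rw [← freq_snd (α := V) p]
    exact freq_pair_affine (a₁ := 0) (a₂ := 1) (by simpa using hb) 0 y fun _ w ↦ p w
  · rw [← freq_snd (α := V) p]
    exact freq_pair_affine (a₁ := 1) (a₂ := 0) (by simpa using hb) 0 y fun _ w ↦ p w

end PairSubstitution

section LargeField

open Polynomial

variable {F V : Type*} [Field F] [AddCommGroup V] [Module F V]

/-- On the points of the line through `x` in direction `h` with parameter in `U`, the function
`f` agrees with a univariate polynomial of degree at most `d`. -/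
def IsLowDegreeOn (d : ℕ) (f : V → F) (U : Finset F) (x h : V) : Prop :=
  ∃ R : F[X], R.natDegree ≤ d ∧ ∀ u ∈ U, R.eval u = f (x + u • h)

lemma exists_extrapolation_weights [DecidableEq F] {d : ℕ} {S : Finset F} (hS : #S = d + 1) :
    ∃ l : F → F, ∀ R : F[X], R.natDegree ≤ d → R.eval 0 = ∑ i ∈ S, l i * R.eval i := by
  refine ⟨fun i ↦ (Lagrange.basis S id i).eval 0, fun R hR ↦ ?_⟩
  have hdeg : R.degree < #S := by
    rw [hS]
    exact (degree_le_of_natDegree_le hR).trans_lt (by exact_mod_cast d.lt_succ_self)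
  conv_lhs => rw [Lagrange.eq_interpolate (s := S) (v := id) (Set.injOn_id _) hdeg]
  simp [Lagrange.interpolate_apply, eval_finsetSum, mul_comm]

lemma eq_of_eval_eq_of_notMem [Fintype F] {d : ℕ} {Q R : F[X]} (hQ : Q.natDegree ≤ d)
    (hR : R.natDegree ≤ d) (A : Finset F) (hA : d + #A < Fintype.card F)
    (h : ∀ t ∉ A, Q.eval t = R.eval t) : Q = R := by
  classical
  have hcard : d < #Aᶜ := by rw [card_compl]; omega
  exact eq_of_degrees_lt_of_eval_finset_eq Aᶜ
    ((degree_le_of_natDegree_le hQ).trans_lt (by exact_mod_cast hcard))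
    ((degree_le_of_natDegree_le hR).trans_lt (by exact_mod_cast hcard))
    fun t ht ↦ h t (mem_compl.1 ht)

variable [Fintype V]

lemma freq_translate_ne (f : V → F) (P : V → V → F[X]) (a u : F) :
    freq (fun z : V × V ↦ (P (z.1 - a • z.2) z.2).eval (a + u) ≠ f (z.1 + u • z.2)) =
      freq fun z : V × V ↦ (P z.1 z.2).eval (a + u) ≠ f (z.1 + (a + u) • z.2) := by
  rw [← freq_pair_affine (a₁ := (1 : F)) (a₂ := -a) (b₁ := 0) (b₂ := 1) (by simp) 0 0
    fun x h ↦ (P x h).eval (a + u) ≠ f (x + (a + u) • h)]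
  refine freq_congr fun z ↦ ?_
  have h₁ : (0 : V) + (1 : F) • z.1 + (-a) • z.2 = z.1 - a • z.2 := by module
  have h₂ : (0 : V) + (0 : F) • z.1 + (1 : F) • z.2 = z.2 := by module
  have h₃ : z.1 - a • z.2 + (a + u) • z.2 = z.1 + u • z.2 := by module
  rw [h₁, h₂, h₃]

variable [Fintype F] {d : ℕ} {f : V → F} {P : V → V → F[X]} {δ : ℝ}

lemma expect_translate_le
    (hδ : 𝔼 t : F, freq (fun z : V × V ↦ (P z.1 z.2).eval t ≠ f (z.1 + t • z.2)) ≤ δ) (u : F) :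
    𝔼 a : F, freq (fun z : V × V ↦
      (P (z.1 - a • z.2) z.2).eval (a + u) ≠ f (z.1 + u • z.2)) ≤ δ := by
  refine le_trans (le_of_eq ?_) hδ
  refine Fintype.expect_equiv (Equiv.addRight u) _ _ fun a ↦ ?_
  exact freq_translate_ne f P a u

lemma freq_not_isLowDegreeOn_le (hP : ∀ x h, (P x h).natDegree ≤ d)
    (hδ : 𝔼 t : F, freq (fun z : V × V ↦ (P z.1 z.2).eval t ≠ f (z.1 + t • z.2)) ≤ δ)
    (U : Finset F) : freq (fun z : V × V ↦ ¬ IsLowDegreeOn d f U z.1 z.2) ≤ #U * δ := by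
  have key : ∀ a : F, freq (fun z : V × V ↦ ¬ IsLowDegreeOn d f U z.1 z.2) ≤
      ∑ u ∈ U, freq fun z : V × V ↦
        (P (z.1 - a • z.2) z.2).eval (a + u) ≠ f (z.1 + u • z.2) := by
    intro a
    refine (freq_mono fun z hz ↦ ?_).trans (freq_exists_le U _)
    by_contra! hcon
    refine hz ⟨(P (z.1 - a • z.2) z.2).comp (C a + X), ?_, fun u hu ↦ ?_⟩
    · rw [natDegree_comp, natDegree_C_add, natDegree_X, mul_one]
      exact hP _ _
    · rw [eval_comp, ← hcon u hu]
      simp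
  calc _ ≤ 𝔼 a : F, ∑ u ∈ U, freq fun z : V × V ↦
        (P (z.1 - a • z.2) z.2).eval (a + u) ≠ f (z.1 + u • z.2) :=
        le_expect univ_nonempty fun a _ ↦ key a
    _ = ∑ u ∈ U, 𝔼 a : F, freq fun z : V × V ↦
        (P (z.1 - a • z.2) z.2).eval (a + u) ≠ f (z.1 + u • z.2) := expect_sum_comm _ _ _
    _ ≤ #U * δ := by
        simpa using Finset.sum_le_card_nsmul U _ δ fun u _ ↦ expect_translate_le hδ u

/-- If random low-degree polynomials predict every value of `φ` with high probability, then `φ`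
is itself given by a low-degree polynomial. -/
lemma exists_eval_eq_of_freq_ne_le {Ω : Type*} [Fintype Ω] [Nonempty Ω]
    (hq : 2 * (d + 1) ≤ Fintype.card F) (Q : Ω → F[X]) (hQ : ∀ ω, (Q ω).natDegree ≤ d)
    (φ : F → F) {ε : ℝ} (hε : 5 * ε < 1) (h : ∀ t, freq (fun ω ↦ (Q ω).eval t ≠ φ t) ≤ ε) :
    ∃ R : F[X], R.natDegree ≤ d ∧ ∀ t, R.eval t = φ t := by
  classical
  have hq0 : (0 : ℝ) < Fintype.card F := by exact_mod_cast Fintype.card_pos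
  set e : Ω → Finset F := fun ω ↦ {t | (Q ω).eval t ≠ φ t}
  have hmean : 𝔼 ω, (#(e ω) : ℝ) ≤ Fintype.card F * ε := by
    rw [expect_card_filter]
    simpa using Finset.sum_le_card_nsmul univ _ ε fun t _ ↦ h t
  have hbad : freq (fun ω ↦ ¬ 4 * #(e ω) ≤ Fintype.card F) ≤ 4 * ε := by
    have := freq_mul_le_expect (p := fun ω ↦ ¬ 4 * #(e ω) ≤ Fintype.card F)
      (φ := fun ω ↦ (#(e ω) : ℝ)) (c := Fintype.card F / 4) (fun _ ↦ by positivity) fun ω hω ↦ by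
        have : (Fintype.card F : ℝ) < 4 * #(e ω) := by exact_mod_cast not_le.1 hω
        linarith
    have h2 : freq (fun ω ↦ ¬ 4 * #(e ω) ≤ Fintype.card F) * Fintype.card F ≤
        4 * ε * Fintype.card F := by linarith
    exact le_of_mul_le_mul_right h2 hq0
  have hε0 : 0 ≤ ε := (freq_nonneg _).trans (h 0)
  obtain ⟨ω₀, hω₀⟩ := exists_not_of_freq_lt_one (hbad.trans_lt (by linarith))
  rw [not_not] at hω₀
  refine ⟨Q ω₀, hQ ω₀, fun t ↦ ?_⟩
  obtain ⟨ω, hω⟩ := exists_not_of_freq_lt_one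
    (((freq_or_le (fun ω ↦ ¬ 4 * #(e ω) ≤ Fintype.card F) _).trans
      (add_le_add hbad (h t))).trans_lt (by linarith))
  push Not at hω
  rw [← hω.2]
  congr 1
  have := card_union_le (e ω₀) (e ω)
  refine eq_of_eval_eq_of_notMem (hQ ω₀) (hQ ω) (e ω₀ ∪ e ω) (by omega) fun s hs ↦ ?_
  simp only [mem_union, e, mem_filter, mem_univ, true_and, not_or, not_not] at hs
  rw [hs.1, hs.2]

/-- The low-degree test over fields whose order is at least twice the degree bound: the
self-corrected function is of low degree on every line. -/
lemma exists_isLowDegreeOn_of_large_card (hP : ∀ x h, (P x h).natDegree ≤ d)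
    (hq : 2 * (d + 1) ≤ Fintype.card F)
    (hδ : 𝔼 t : F, freq (fun z : V × V ↦ (P z.1 z.2).eval t ≠ f (z.1 + t • z.2)) ≤ δ)
    (hδd : 200 * (d + 1) ^ 2 * δ ≤ 1) :
    ∃ g : V → F, (∀ x h, IsLowDegreeOn d g univ x h) ∧ freq (fun x ↦ f x ≠ g x) ≤ 1 / 16 := by
  classical
  have hδ0 : 0 ≤ δ := le_trans (expect_nonneg fun _ _ ↦ freq_nonneg _) hδ
  obtain ⟨S, hS0, hS⟩ : ∃ S ⊆ univ.erase (0 : F), #S = d + 1 :=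
    exists_subset_card_eq (by rw [card_erase_of_mem (mem_univ _), card_univ]; omega)
  have h0S : (0 : F) ∉ S := fun h ↦ by simpa using hS0 h
  have hSne : ∀ i ∈ S, i ≠ 0 := fun i hi h ↦ h0S (h ▸ hi)
  obtain ⟨l, hl⟩ := exists_extrapolation_weights hS
  set U := insert 0 S
  have hU : #U = d + 2 := by rw [card_insert_of_notMem h0S, hS]
  set ρ : ℝ := (d + 2) * δ
  have hρ : freq (fun z : V × V ↦ ¬ IsLowDegreeOn d f U z.1 z.2) ≤ ρ := by
    simpa [hU] using freq_not_isLowDegreeOn_le hP hδ U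
  set v : V → V → F := fun x h ↦ ∑ i ∈ S, l i * f (x + i • h)
  have hgood : ∀ x h, IsLowDegreeOn d f U x h → v x h = f x := by
    rintro x h ⟨R, hR, hRU⟩
    have := hl R hR
    rw [hRU 0 (mem_insert_self _ _), zero_smul, add_zero] at this
    rw [this]
    exact sum_congr rfl fun i hi ↦ by rw [hRU i (mem_insert_of_mem hi)]
  set β : ℝ := 2 * ((d + 1) * ρ)
  have hcoll : ∀ x, freq (fun z : V × V ↦ v x z.1 ≠ v x z.2) ≤ β := by
    intro x
    have h₁ : freq (fun z : V × V ↦ ∃ i ∈ S, ¬ IsLowDegreeOn d f U (x + i • z.1) z.2) ≤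
        (d + 1) * ρ := by
      have := freq_exists_le_mul S
        (fun i (z : V × V) ↦ ¬ IsLowDegreeOn d f U (x + i • z.1) z.2) (ε := ρ) fun i hi ↦ by
          refine le_of_eq_of_le ?_ hρ
          rw [← freq_pair_affine (a₁ := i) (a₂ := 0) (b₁ := 0) (b₂ := 1)
            (by simpa using hSne i hi) x 0 fun a b ↦ ¬ IsLowDegreeOn d f U a b]
          simp
      simpa [hS] using this
    have h₂ : freq (fun z : V × V ↦ ∃ i ∈ S, ¬ IsLowDegreeOn d f U (x + i • z.2) z.1) ≤
        (d + 1) * ρ := by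
      have := freq_exists_le_mul S
        (fun i (z : V × V) ↦ ¬ IsLowDegreeOn d f U (x + i • z.2) z.1) (ε := ρ) fun i hi ↦ by
          refine le_of_eq_of_le ?_ hρ
          rw [← freq_pair_affine (a₁ := 0) (a₂ := i) (b₁ := 1) (b₂ := 0)
            (by simpa using hSne i hi) x 0 fun a b ↦ ¬ IsLowDegreeOn d f U a b]
          simp
      simpa [hS] using this
    refine (freq_mono fun z hz ↦ ?_).trans
      ((freq_or_le _ _).trans ((add_le_add h₁ h₂).trans_eq (two_mul _).symm))
    by_contra! hcon
    apply hz
    calc v x z.1 = ∑ i ∈ S, l i * v (x + i • z.1) z.2 :=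
          sum_congr rfl fun i hi ↦ by rw [hgood _ _ (hcon.1 i hi)]
      _ = ∑ i ∈ S, l i * v (x + i • z.2) z.1 := by
          simp only [v, mul_sum]
          rw [sum_comm]
          refine sum_congr rfl fun i _ ↦ sum_congr rfl fun j _ ↦ ?_
          rw [add_right_comm, mul_left_comm]
      _ = v x z.2 := sum_congr rfl fun i hi ↦ by rw [hgood _ _ (hcon.2 i hi)]
  choose g hg using fun x ↦ exists_freq_ne_le (v x)
  replace hg : ∀ x, freq (fun h ↦ v x h ≠ g x) ≤ β := fun x ↦ (hg x).trans (hcoll x)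
  have hd0 : (0 : ℝ) ≤ d := d.cast_nonneg
  refine ⟨g, fun x h ↦ ?_, ?_⟩
  · set Q : F × (V × V) → F[X] := fun ω ↦ ∑ i ∈ S, C (l i) *
      (P (x + i • ω.2.1 - ω.1 • (h + i • ω.2.2)) (h + i • ω.2.2)).comp (C ω.1 + X)
    have hQ : ∀ ω, (Q ω).natDegree ≤ d := fun ω ↦ by
      refine natDegree_sum_le_of_forall_le _ _ fun i _ ↦ (natDegree_C_mul_le _ _).trans ?_
      rw [natDegree_comp, natDegree_C_add, natDegree_X, mul_one]
      exact hP _ _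
    obtain ⟨R, hR, hRe⟩ := exists_eval_eq_of_freq_ne_le hq Q hQ (fun t ↦ g (x + t • h))
      (ε := (d + 1) * δ + β) (by simp only [β, ρ]; nlinarith) fun t ↦ by
        have h₁ : freq (fun ω : F × (V × V) ↦ ∃ i ∈ S,
            (P (x + i • ω.2.1 - ω.1 • (h + i • ω.2.2)) (h + i • ω.2.2)).eval (ω.1 + t) ≠
              f (x + i • ω.2.1 + t • (h + i • ω.2.2))) ≤ (d + 1) * δ := by
          have := freq_exists_le_mul S (fun i (ω : F × (V × V)) ↦
            (P (x + i • ω.2.1 - ω.1 • (h + i • ω.2.2)) (h + i • ω.2.2)).eval (ω.1 + t) ≠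
              f (x + i • ω.2.1 + t • (h + i • ω.2.2))) (ε := δ) fun i hi ↦ by
            refine le_of_eq_of_le ?_ (expect_translate_le hδ t)
            rw [freq_prod]
            refine expect_congr rfl fun a _ ↦ ?_
            rw [← freq_pair_affine (a₁ := i) (a₂ := 0) (b₁ := 0) (b₂ := i)
              (by simpa using hSne i hi) x h
              fun y k ↦ (P (y - a • k) k).eval (a + t) ≠ f (y + t • k)]
            simp
          simpa [hS] using this
        have h₂ : freq (fun ω : F × (V × V) ↦
            v (x + t • h) (ω.2.1 + t • ω.2.2) ≠ g (x + t • h)) ≤ β := by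
          refine le_of_eq_of_le ?_ (hg (x + t • h))
          rw [freq_snd (α := F)
            fun z : V × V ↦ v (x + t • h) (z.1 + t • z.2) ≠ g (x + t • h)]
          rw [← freq_pair_affine_single (b₁ := (1 : F)) (b₂ := t) (by simp) 0
            fun k ↦ v (x + t • h) k ≠ g (x + t • h)]
          simp
        refine (freq_mono fun ω hω ↦ ?_).trans ((freq_or_le _ _).trans (add_le_add h₁ h₂))
        by_contra! hcon
        apply hω
        rw [← hcon.2, eval_finsetSum]
        refine sum_congr rfl fun i hi ↦ ?_
        have := hcon.1 i hi
        simp only [eval_mul, eval_C, eval_comp, eval_add, eval_X, this]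
        congr 2
        module
    exact ⟨R, hR, fun u _ ↦ hRe u⟩
  · have h₁ : freq (fun z : V × V ↦ v z.1 z.2 ≠ g z.1) ≤ β := by
      rw [freq_prod]
      exact expect_le univ_nonempty fun x _ ↦ hg x
    calc freq (fun x ↦ f x ≠ g x) = freq fun z : V × V ↦ f z.1 ≠ g z.1 :=
          (freq_fst _).symm
      _ ≤ freq (fun z : V × V ↦ ¬ IsLowDegreeOn d f U z.1 z.2 ∨ v z.1 z.2 ≠ g z.1) :=
          freq_mono fun z hz ↦ by
            by_contra! hcon
            exact hz (by rw [← hcon.2, hgood _ _ hcon.1])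
      _ ≤ ρ + β := (freq_or_le _ _).trans (add_le_add hρ h₁)
      _ ≤ 1 / 16 := by simp only [β, ρ]; nlinarith

end LargeField

section LineMoments

variable {F V : Type*} [Field F] [Fintype F] [AddCommGroup V] [Module F V] [Fintype V]

lemma freq_and_prod {α β : Type*} [Fintype α] [Fintype β] (p : α → Prop) (q : β → Prop) :
    freq (fun z : α × β ↦ p z.1 ∧ q z.2) = freq p * freq q := by
  rw [freq_prod, freq, expect_mul]
  refine expect_congr rfl fun a _ ↦ ?_
  by_cases ha : p a
  · simp only [ha, true_and, if_true, one_mul]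
  · simp [ha, freq]

lemma expect_card_line (p : V → Prop) [DecidablePred p] :
    𝔼 z : V × V, (#{t : F | p (z.1 + t • z.2)} : ℝ) = Fintype.card F * freq p := by
  rw [expect_card_filter, Finset.sum_congr rfl (g := fun _ ↦ freq p) fun t _ ↦ ?_]
  · simp
  · rw [← freq_pair_affine_single (b₁ := (1 : F)) (b₂ := t) (by simp) 0 p]
    simp

/-- Distinct points of a uniformly random line are pairwise independent. -/
lemma expect_card_line_mul_card_sub_one (p : V → Prop) [DecidablePred p] :
    𝔼 z : V × V, ((#{t : F | p (z.1 + t • z.2)} : ℝ) * (#{t : F | p (z.1 + t • z.2)} - 1)) =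
      Fintype.card F * (Fintype.card F - 1) * freq p ^ 2 := by
  classical
  calc _ = 𝔼 z : V × V, (#{i ∈ (univ : Finset F).offDiag |
        p (z.1 + i.1 • z.2) ∧ p (z.1 + i.2 • z.2)} : ℝ) := by
        refine expect_congr rfl fun z _ ↦ ?_
        have : {i ∈ (univ : Finset F).offDiag | p (z.1 + i.1 • z.2) ∧ p (z.1 + i.2 • z.2)} =
            ({t : F | p (z.1 + t • z.2)} : Finset F).offDiag := by
          ext i
          simp only [mem_filter, mem_offDiag, mem_univ, true_and]
          tauto
        rw [this, offDiag_card, Nat.cast_sub (Nat.le_mul_self _)]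
        push_cast
        ring
    _ = _ := by
        rw [expect_card_filter (univ : Finset F).offDiag
          fun i (z : V × V) ↦ p (z.1 + i.1 • z.2) ∧ p (z.1 + i.2 • z.2),
          Finset.sum_congr rfl (g := fun _ ↦ freq p ^ 2) fun t ht ↦ ?_]
        · rw [sum_const, offDiag_card, nsmul_eq_mul, Nat.cast_sub (Nat.le_mul_self _)]
          push_cast
          rw [card_univ]
          ring
        · rw [sq, ← freq_and_prod, ← freq_pair_affine (a₁ := (1 : F)) (a₂ := t.1) (b₁ := 1)
            (b₂ := t.2) _ 0 0 fun x y ↦ p x ∧ p y]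
          · simp
          · simpa [sub_eq_zero] using (mem_offDiag.1 ht).2.2.symm

open Polynomial in
/-- A function of low degree on every line which is moderately close to `f` is in fact as close
to `f` as the rejection probability of the test predicts. -/
lemma freq_ne_le_two_mul {d : ℕ} {f g : V → F} {P : V → V → F[X]} {δ : ℝ}
    (hP : ∀ x h, (P x h).natDegree ≤ d)
    (hδ : 𝔼 t : F, freq (fun z : V × V ↦ (P z.1 z.2).eval t ≠ f (z.1 + t • z.2)) ≤ δ)
    (hg : ∀ x h, IsLowDegreeOn d g univ x h) (hq : d + 2 ≤ Fintype.card F)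
    (hfg : 8 * Fintype.card F * freq (fun x ↦ f x ≠ g x) ≤ Fintype.card F - d) :
    freq (fun x ↦ f x ≠ g x) ≤ 2 * δ := by
  classical
  set η := freq fun x ↦ f x ≠ g x
  set r : ℝ := Fintype.card F - d
  have hq' : (d : ℝ) + 2 ≤ Fintype.card F := by exact_mod_cast hq
  have hr2 : 2 ≤ r := by linarith
  have hd0 : (0 : ℝ) ≤ d := d.cast_nonneg
  have hη0 : 0 ≤ η := freq_nonneg _
  set K : V × V → Finset F := fun z ↦ {t : F | f (z.1 + t • z.2) ≠ g (z.1 + t • z.2)}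
  set E : V × V → Finset F := fun z ↦ {t : F | (P z.1 z.2).eval t ≠ f (z.1 + t • z.2)}
  have hline : ∀ z, r * #(K z) ≤ 4 * ((#(K z) : ℝ) * (#(K z) - 1)) + r * #(E z) := by
    intro z
    obtain ⟨R, hR, hRg⟩ := hg z.1 z.2
    have hk : (0 : ℝ) ≤ #(K z) * (#(K z) - 1) := by
      rcases Nat.eq_zero_or_pos (#(K z)) with h | h
      · simp [h]
      · have : (1 : ℝ) ≤ #(K z) := by exact_mod_cast h
        exact mul_nonneg (by linarith) (by linarith)
    by_cases hPR : P z.1 z.2 = R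
    · have : #(E z) = #(K z) := by
        simp only [E, K, hPR]
        congr 1
        ext t
        simp [hRg t (mem_univ t), ne_comm]
      rw [this]
      linarith
    · have hcard : Fintype.card F ≤ d + (#(E z) + #(K z)) := by
        by_contra! hlt
        have := card_union_le (E z) (K z)
        refine hPR (eq_of_eval_eq_of_notMem (hP _ _) hR (E z ∪ K z) (by omega) fun t ht ↦ ?_)
        simp only [mem_union, E, K, mem_filter, mem_univ, true_and, not_or, not_not] at ht
        rw [ht.1, ht.2, hRg t (mem_univ t)]
      have hcard' : r ≤ #(E z) + #(K z) := by
        have : (Fintype.card F : ℝ) ≤ d + (#(E z) + #(K z)) := by exact_mod_cast hcard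
        linarith
      nlinarith [sq_nonneg (2 * (#(K z) : ℝ) - r),
        mul_nonneg (#(K z)).cast_nonneg (sub_nonneg.2 hr2),
        mul_le_mul_of_nonneg_left hcard' (by linarith : (0 : ℝ) ≤ r)]
  have hE : 𝔼 z, (#(E z) : ℝ) ≤ Fintype.card F * δ := by
    rw [expect_card_filter]
    rw [Fintype.expect_eq_sum_div_card, div_le_iff₀ (by linarith)] at hδ
    linarith
  have hmean : r * 𝔼 z, (#(K z) : ℝ) ≤
      4 * 𝔼 z, ((#(K z) : ℝ) * (#(K z) - 1)) + r * 𝔼 z, (#(E z) : ℝ) := by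
    rw [mul_expect, mul_expect, mul_expect, ← expect_add_distrib]
    exact expect_le_expect fun z _ ↦ hline z
  have h₁ : 𝔼 z, (#(K z) : ℝ) = Fintype.card F * η := expect_card_line fun x ↦ f x ≠ g x
  have h₂ : 𝔼 z, ((#(K z) : ℝ) * (#(K z) - 1)) = Fintype.card F * (Fintype.card F - 1) * η ^ 2 :=
    expect_card_line_mul_card_sub_one fun x ↦ f x ≠ g x
  rw [h₁, h₂] at hmean
  set q : ℝ := (Fintype.card F : ℝ)
  have hq0 : 0 < q := by linarith
  have h₃ : r * 𝔼 z, (#(E z) : ℝ) ≤ r * (q * δ) := mul_le_mul_of_nonneg_left hE (by linarith)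
  have h₄ : 8 * (q - 1) * η ≤ r := by nlinarith
  have h₅ : 8 * (q - 1) * η * (q * η) ≤ r * (q * η) :=
    mul_le_mul_of_nonneg_right h₄ (by positivity)
  have h₆ : (r * q) * η ≤ (r * q) * (2 * δ) := by nlinarith
  exact le_of_mul_le_mul_left h₆ (by positivity)

end LineMoments

section Plane

variable {F : Type*} [Field F] [Fintype F]

lemma sum_ite_affine_eq_one [DecidableEq F] (b c z : F) :
    ∑ s : F, (if b + s * c = 1 then z else 0) = if c ≠ 0 then z else 0 := by
  by_cases hc : c = 0
  · by_cases hb : b = 1 <;> simp [hc, hb]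
  · have : ∀ s, b + s * c = 1 ↔ s = (1 - b) / c := fun s ↦ by
      rw [eq_div_iff hc, eq_sub_iff_add_eq, add_comm]
    simp [this, hc]

lemma sum_affine_line_eq [DecidableEq F] {u : F × F} (hu : u ≠ 0) (p : F × F)
    (φ : F × F → F) :
    ∑ y, (if u.1 * y.1 + u.2 * y.2 = u.1 * p.1 + u.2 * p.2 then φ y else 0) =
      ∑ r : F, φ (p + r • (-u.2, u.1)) := by
  obtain ⟨z₁, z₂, hz⟩ : ∃ z₁ z₂ : F, z₁ * (-u.2) + z₂ * u.1 = 1 := by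
    by_cases h : u.1 = 0
    · have h2 : u.2 ≠ 0 := fun h2 ↦ hu (Prod.ext h h2)
      exact ⟨-u.2⁻¹, 0, by simp [h2]⟩
    · exact ⟨0, u.1⁻¹, by simp [h]⟩
  rw [← sum_filter]
  refine sum_nbij' (fun y ↦ z₁ * (y.1 - p.1) + z₂ * (y.2 - p.2))
    (fun r ↦ p + r • (-u.2, u.1)) (by simp) (fun r _ ↦ ?_) (fun y hy ↦ ?_) (fun r _ ↦ ?_)
    fun y hy ↦ ?_
  · simp only [mem_filter, mem_univ, true_and, Prod.fst_add, Prod.smul_fst, smul_eq_mul,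
      Prod.snd_add, Prod.smul_snd]
    ring
  · have hy := (mem_filter.1 hy).2
    ext
    · simp only [Prod.fst_add, Prod.smul_fst, smul_eq_mul]
      linear_combination (y.1 - p.1) * hz - z₂ * hy
    · simp only [Prod.snd_add, Prod.smul_snd, smul_eq_mul]
      linear_combination (y.2 - p.2) * hz + z₁ * hy
  · simp only [Prod.fst_add, Prod.smul_fst, smul_eq_mul, Prod.snd_add, Prod.smul_snd]
    linear_combination r * hz
  · have hy := (mem_filter.1 hy).2
    congr 1
    ext
    · simp only [Prod.fst_add, Prod.smul_fst, smul_eq_mul]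
      linear_combination -(y.1 - p.1) * hz + z₂ * hy
    · simp only [Prod.snd_add, Prod.smul_snd, smul_eq_mul]
      linear_combination -(y.2 - p.2) * hz - z₁ * hy

open scoped Classical in
/-- The sum of `φ` over the affine line of the points whose pairing with `u` is `1`. -/
noncomputable def dualLineSum (φ : F × F → F) (u : F × F) : F :=
  ∑ y, if u.1 * y.1 + u.2 * y.2 = 1 then φ y else 0

lemma dualLineSum_zero (φ : F × F → F) : dualLineSum φ 0 = 0 := by simp [dualLineSum]

/-- The sum of `dualLineSum φ` over a line depends only on the direction of the line. -/
lemma sum_dualLineSum [DecidableEq F] (φ : F × F → F) (u v : F × F) :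
    ∑ s : F, dualLineSum φ (u + s • v) =
      ∑ y, if v.1 * y.1 + v.2 * y.2 ≠ 0 then φ y else 0 := by
  simp only [dualLineSum]
  rw [sum_comm]
  refine sum_congr rfl fun y _ ↦ ?_
  rw [← sum_ite_affine_eq_one (u.1 * y.1 + u.2 * y.2) _ (φ y)]
  refine sum_congr rfl fun s _ ↦ ?_
  have : (u + s • v).1 * y.1 + (u + s • v).2 * y.2 =
      u.1 * y.1 + u.2 * y.2 + s * (v.1 * y.1 + v.2 * y.2) := by
    simp only [Prod.fst_add, Prod.smul_fst, smul_eq_mul, Prod.snd_add, Prod.smul_snd]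
    ring
  rw [this]
  congr

/-- If the sums over parallel lines of a function vanishing at the origin always agree, then the
function vanishes identically or has large support. -/
lemma eq_zero_of_two_mul_card_support_le [DecidableEq F] {w : F × F → F} (hw0 : w 0 = 0)
    (hw : ∀ u v, ∑ s : F, w (u + s • v) = ∑ s : F, w (s • v))
    (hcard : 2 * #{u | w u ≠ 0} ≤ Fintype.card F) (u : F × F) : w u = 0 := by
  by_contra hu
  have hu0 : u ≠ 0 := fun h ↦ hu (h ▸ hw0)
  obtain ⟨v, hv⟩ : ∃ v : F × F, u.1 * v.2 - u.2 * v.1 = 1 := by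
    by_cases h : u.1 = 0
    · have h2 : u.2 ≠ 0 := fun h2 ↦ hu0 (Prod.ext h h2)
      exact ⟨(-u.2⁻¹, 0), by simp [h2]⟩
    · exact ⟨(0, u.1⁻¹), by simp [h]⟩
  set W : Finset (F × F) := {x | w x ≠ 0}
  set W' := W.erase u
  have hcover : (univ : Finset F) ⊆
      W'.image (fun x ↦ (x.1 * v.2 - x.2 * v.1) / (u.1 * x.2 - u.2 * x.1)) ∪
      W'.image (fun x ↦ (x.1 * v.2 - x.2 * v.1 - 1) / (u.1 * x.2 - u.2 * x.1)) := by
    intro a _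
    by_contra hcon
    simp only [mem_union, mem_image, not_or, not_exists, not_and, W', W, mem_erase, mem_filter,
      mem_univ, true_and, and_imp] at hcon
    obtain ⟨h₁, h₂⟩ := hcon
    have e₁ : ∀ s : F, w (s • (v + a • u)) = 0 := by
      intro s
      by_contra hs
      have hs0 : s ≠ 0 := by rintro rfl; simp [hw0] at hs
      have hdet : u.1 * (s • (v + a • u)).2 - u.2 * (s • (v + a • u)).1 = s := by
        simp only [Prod.fst_add, Prod.smul_fst, smul_eq_mul, Prod.snd_add, Prod.smul_snd]
        linear_combination s * hv
      refine h₁ _ (fun h ↦ hs0 ?_) hs ?_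
      · rw [h] at hdet
        linear_combination -hdet
      · rw [hdet, div_eq_iff hs0]
        simp only [Prod.fst_add, Prod.smul_fst, smul_eq_mul, Prod.snd_add, Prod.smul_snd]
        linear_combination a * s * hv
    have e₂ : ∀ s : F, s ≠ 0 → w (u + s • (v + a • u)) = 0 := by
      intro s hs0
      by_contra hs
      have hdet : u.1 * (u + s • (v + a • u)).2 - u.2 * (u + s • (v + a • u)).1 = s := by
        simp only [Prod.fst_add, Prod.smul_fst, smul_eq_mul, Prod.snd_add, Prod.smul_snd]
        linear_combination s * hv
      refine h₂ _ (fun h ↦ hs0 ?_) hs ?_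
      · rw [h] at hdet
        linear_combination -hdet
      · rw [hdet, div_eq_iff hs0]
        simp only [Prod.fst_add, Prod.smul_fst, smul_eq_mul, Prod.snd_add, Prod.smul_snd]
        linear_combination (1 + a * s) * hv
    have := hw u (v + a • u)
    rw [sum_eq_single_of_mem 0 (mem_univ _) fun s _ hs ↦ e₂ s hs,
      sum_eq_zero fun s _ ↦ e₁ s] at this
    simp [hu] at this
  have h₁ := (card_le_card hcover).trans ((card_union_le _ _).trans
    (add_le_add card_image_le card_image_le))
  have h₂ : #W' < #W := card_erase_lt_of_mem (by simpa [W] using hu)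
  rw [card_univ] at h₁
  omega

/-- If a function on the plane sums to zero over almost every line avoiding the origin, then its
sums over the lines through the origin all agree. -/
lemma sum_smul_eq_sum_of_card_dualLineSum_le [DecidableEq F] {φ : F × F → F}
    (hφ : 2 * #{u | dualLineSum φ u ≠ 0} ≤ Fintype.card F) {y : F × F} (hy : y ≠ 0) :
    ∑ r : F, φ (r • y) = ∑ z, φ z := by
  have hzero := eq_zero_of_two_mul_card_support_le (dualLineSum_zero φ)
    (fun u v ↦ by
      rw [sum_dualLineSum, ← sum_dualLineSum φ 0 v]
      simp) hφ
  have hu : (y.2, -y.1) ≠ (0 : F × F) := fun h ↦ hy <| by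
    simp only [Prod.mk_eq_zero, neg_eq_zero] at h
    exact Prod.ext h.2 h.1
  have h₁ := sum_dualLineSum φ 0 (y.2, -y.1)
  rw [sum_eq_zero fun s _ ↦ hzero _] at h₁
  have h₂ := sum_affine_line_eq hu 0 φ
  simp only [neg_neg, zero_add, Prod.fst_zero, Prod.snd_zero, mul_zero] at h₂
  refine h₂.symm.trans (Eq.trans ?_ (sum_filter_add_sum_filter_not univ
    (fun z : F × F ↦ y.2 * z.1 + -y.1 * z.2 = 0) φ))
  rw [sum_filter, sum_filter, ← h₁, add_zero]

end Plane

section SmallField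

open Polynomial

variable {F V : Type*} [Field F] [Fintype F] [AddCommGroup V] [Module F V]
  {d : ℕ} {f : V → F}

lemma IsLowDegreeOn.sum_eq_zero (hq : d + 2 ≤ Fintype.card F) {x h : V}
    (hf : IsLowDegreeOn d f univ x h) : ∑ t : F, f (x + t • h) = 0 := by
  obtain ⟨R, hR, hRf⟩ := hf
  rw [← sum_congr rfl hRf]
  simp only [eval_eq_sum_range' (Nat.lt_succ_of_le hR)]
  rw [sum_comm]
  refine Finset.sum_eq_zero fun i hi ↦ ?_
  rw [← mul_sum, FiniteField.sum_pow_lt_card_sub_one, mul_zero]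
  have := mem_range.1 hi
  omega

/-- The value at `x` predicted from the other points of the line in direction `h`, assuming that
the sum over the line vanishes. -/
noncomputable def lineVote [DecidableEq F] (f : V → F) (x h : V) : F :=
  -∑ s ∈ univ.erase (0 : F), f (x + s • h)

lemma lineVote_add_sum [DecidableEq F] (f : V → F) (x h : V) :
    lineVote f x h + ∑ s : F, f (x + s • h) = f x := by
  rw [lineVote, ← add_sum_erase _ _ (mem_univ (0 : F))]
  simp

lemma IsLowDegreeOn.lineVote_eq [DecidableEq F] (hq : d + 2 ≤ Fintype.card F) {x h : V}
    (hf : IsLowDegreeOn d f univ x h) : lineVote f x h = f x := by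
  rw [← lineVote_add_sum f x h, hf.sum_eq_zero hq, add_zero]

variable [Fintype V] {ρ : ℝ}

lemma freq_dualLineSum_ne_zero_le (hq : d + 2 ≤ Fintype.card F)
    (hρ : freq (fun z : V × V ↦ ¬ IsLowDegreeOn d f univ z.1 z.2) ≤ ρ) (x : V) (u : F × F) :
    freq (fun z : V × V ↦ dualLineSum (fun y ↦ f (x + y.1 • z.1 + y.2 • z.2)) u ≠ 0) ≤ ρ := by
  classical
  by_cases hu : u = 0
  · refine le_trans ?_ ((freq_nonneg _).trans hρ)
    simp [hu, dualLineSum_zero, freq]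
  obtain ⟨p, hp⟩ : ∃ p : F × F, u.1 * p.1 + u.2 * p.2 = 1 := by
    by_cases h : u.1 = 0
    · have h2 : u.2 ≠ 0 := fun h2 ↦ hu (Prod.ext h h2)
      exact ⟨(0, u.2⁻¹), by simp [h2]⟩
    · exact ⟨(u.1⁻¹, 0), by simp [h]⟩
  have hdet : p.1 * u.1 - p.2 * -u.2 ≠ 0 := by
    rw [show p.1 * u.1 - p.2 * -u.2 = 1 by linear_combination hp]
    exact one_ne_zero
  rw [← freq_pair_affine hdet x 0 fun a b ↦ ¬ IsLowDegreeOn d f univ a b] at hρ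
  refine (freq_mono fun z hz hgood ↦ hz ?_).trans hρ
  rw [← hgood.sum_eq_zero hq]
  have := sum_affine_line_eq hu p fun y ↦ f (x + y.1 • z.1 + y.2 • z.2)
  rw [hp] at this
  unfold dualLineSum
  convert this using 2
  refine congrArg f ?_
  simp only [Prod.fst_add, Prod.smul_fst, smul_eq_mul, Prod.snd_add, Prod.smul_snd]
  module

lemma freq_exists_lineVote_ne_le [DecidableEq F] (hq : d + 2 ≤ Fintype.card F)
    (hρ : freq (fun z : V × V ↦ ¬ IsLowDegreeOn d f univ z.1 z.2) ≤ ρ) (x : V) :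
    freq (fun z : V × V ↦ ∃ y : F × F, y ≠ 0 ∧
      lineVote f x (y.1 • z.1 + y.2 • z.2) ≠ lineVote f x z.1) ≤ 2 * Fintype.card F * ρ := by
  classical
  have hq0 : (0 : ℝ) < Fintype.card F := by exact_mod_cast Fintype.card_pos
  set W : V × V → Finset (F × F) := fun z ↦
    {u | dualLineSum (fun y ↦ f (x + y.1 • z.1 + y.2 • z.2)) u ≠ 0}
  have hW : 𝔼 z, (#(W z) : ℝ) ≤ Fintype.card F ^ 2 * ρ := by
    rw [expect_card_filter]
    refine (Finset.sum_le_card_nsmul univ _ ρ fun u _ ↦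
      freq_dualLineSum_ne_zero_le hq hρ x u).trans_eq ?_
    simp [sq]
  have hmarkov := freq_mul_le_expect (p := fun z ↦ ¬ 2 * #(W z) ≤ Fintype.card F)
    (φ := fun z ↦ (#(W z) : ℝ)) (c := Fintype.card F / 2) (fun _ ↦ by positivity) fun z hz ↦ by
      have : (Fintype.card F : ℝ) < 2 * #(W z) := by exact_mod_cast not_le.1 hz
      linarith
  have hbad : freq (fun z ↦ ¬ 2 * #(W z) ≤ Fintype.card F) ≤ 2 * Fintype.card F * ρ :=
    le_of_mul_le_mul_right (by nlinarith) hq0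
  refine (freq_mono fun z hz hgood ↦ ?_).trans hbad
  obtain ⟨y, hy, hne⟩ := hz
  have key : ∀ y : F × F, y ≠ 0 →
      lineVote f x (y.1 • z.1 + y.2 • z.2) = f x - ∑ y : F × F, f (x + y.1 • z.1 + y.2 • z.2) := by
    intro y hy
    rw [eq_sub_iff_add_eq, ← sum_smul_eq_sum_of_card_dualLineSum_le hgood hy,
      ← lineVote_add_sum f x (y.1 • z.1 + y.2 • z.2)]
    congr 1
    refine sum_congr rfl fun s _ ↦ congrArg f ?_
    simp only [Prod.smul_fst, smul_eq_mul, Prod.smul_snd]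
    module
  apply hne
  have h10 := key (1, 0) (by simp)
  simp only [one_smul, zero_smul, add_zero] at h10
  rw [key y hy, h10]

/-- If the votes along almost all planes through `x` agree, then almost all votes at `x` agree,
with a gain of a factor of the order of the field. -/
lemma exists_freq_lineVote_ne_le [DecidableEq F] (hq : d + 2 ≤ Fintype.card F)
    (hρ : freq (fun z : V × V ↦ ¬ IsLowDegreeOn d f univ z.1 z.2) ≤ ρ)
    (hρq : 8 * Fintype.card F * ρ ≤ 1) (x : V) :
    ∃ c, freq (fun h ↦ lineVote f x h ≠ c) ≤ 8 * ρ := by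
  classical
  have hρ0 : 0 ≤ ρ := (freq_nonneg _).trans hρ
  have hq0 : (0 : ℝ) < Fintype.card F := by exact_mod_cast Fintype.card_pos
  set q : ℝ := (Fintype.card F : ℝ)
  have hplane := freq_exists_lineVote_ne_le hq hρ x
  obtain ⟨c, hc⟩ := exists_freq_ne_le (lineVote f x)
  refine ⟨c, ?_⟩
  set β := freq fun h ↦ lineVote f x h ≠ c
  have hβ0 : 0 ≤ β := freq_nonneg _
  have hβ : β ≤ 2 * q * ρ := hc.trans <| (freq_mono fun z hz ↦
    ⟨(0, 1), by simp, by simpa using hz.symm⟩).trans hplane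
  set X : V × V → ℕ := fun z ↦ #{r : F | lineVote f x (z.1 + r • z.2) ≠ c}
  have hX : freq (fun z ↦ X z ≠ 0) ≤ 4 * q * ρ := by
    calc freq (fun z ↦ X z ≠ 0) ≤ freq fun z : V × V ↦ (∃ y : F × F, y ≠ 0 ∧
          lineVote f x (y.1 • z.1 + y.2 • z.2) ≠ lineVote f x z.1) ∨ lineVote f x z.1 ≠ c := by
          refine freq_mono fun z hz ↦ ?_
          obtain ⟨r, hr⟩ := card_pos.1 (Nat.pos_of_ne_zero hz)
          have hr := (mem_filter.1 hr).2
          by_contra! hcon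
          have := hcon.1 (1, r) (by simp)
          rw [one_smul] at this
          exact hr (this.trans hcon.2)
      _ ≤ 2 * q * ρ + 2 * q * ρ := (freq_or_le _ _).trans (add_le_add hplane
          ((freq_fst fun h ↦ lineVote f x h ≠ c).trans_le hβ))
      _ = 4 * q * ρ := by ring
  have h₁ : 𝔼 z, (X z : ℝ) = q * β := expect_card_line fun h ↦ lineVote f x h ≠ c
  have h₂ : 𝔼 z, ((X z : ℝ) * (X z - 1)) = q * (q - 1) * β ^ 2 :=
    expect_card_line_mul_card_sub_one fun h ↦ lineVote f x h ≠ c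
  rcases hρ0.eq_or_lt with hρ0 | hρ0
  · rw [← hρ0] at hβ ⊢
    linarith
  set a := 4 * q * ρ
  set b := q * β with hb
  have ha0 : 0 < a := by positivity
  have hb0 : 0 ≤ b := by positivity
  have hmom : 2 * a * b * 𝔼 z, (X z : ℝ) ≤
      a ^ 2 * 𝔼 z, ((X z : ℝ) * (X z - 1)) + a ^ 2 * 𝔼 z, (X z : ℝ) +
        b ^ 2 * freq fun z ↦ X z ≠ 0 := by
    rw [freq, mul_expect, mul_expect, mul_expect, mul_expect, ← expect_add_distrib,
      ← expect_add_distrib]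
    refine expect_le_expect fun z _ ↦ ?_
    by_cases hz : X z = 0
    · simp [hz]
    · simp only [ne_eq, hz, not_false_eq_true, if_true]
      nlinarith [sq_nonneg (a * (X z : ℝ) - b)]
  rw [h₁, h₂] at hmom
  have h₃ : q * (q - 1) * β ^ 2 ≤ b ^ 2 := by rw [hb]; nlinarith [sq_nonneg β]
  have h₄ : b ^ 2 * freq (fun z ↦ X z ≠ 0) ≤ b ^ 2 * a :=
    mul_le_mul_of_nonneg_left hX (sq_nonneg b)
  have h₅ : a * b ^ 2 ≤ a * (a * (b ^ 2 + b)) := by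
    have := mul_le_mul_of_nonneg_left h₃ (sq_nonneg a)
    nlinarith
  have h₆ : b ^ 2 ≤ a * (b ^ 2 + b) := le_of_mul_le_mul_left h₅ ha0
  have ha1 : a ≤ 1 / 2 := by linarith
  have h₇ : b ≤ 2 * a := by
    rcases hb0.eq_or_lt with hb0 | hb0
    · linarith
    · have : b * b ≤ b * (a * (b + 1)) := by nlinarith
      have := le_of_mul_le_mul_left this hb0
      nlinarith
  exact le_of_mul_le_mul_left (by linarith) hq0

/-- The low-degree test over fields whose order is close to the degree bound: the self-corrected
function is of low degree on every line. -/
lemma exists_isLowDegreeOn_of_freq_le (hq : d + 2 ≤ Fintype.card F)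
    (hρ : freq (fun z : V × V ↦ ¬ IsLowDegreeOn d f univ z.1 z.2) ≤ ρ)
    (hρq : 36 * Fintype.card F * ρ ≤ 1) :
    ∃ g : V → F, (∀ x h, IsLowDegreeOn d g univ x h) ∧ freq (fun x ↦ f x ≠ g x) ≤ 9 * ρ := by
  classical
  have hρ0 : 0 ≤ ρ := (freq_nonneg _).trans hρ
  have hq0 : (0 : ℝ) < Fintype.card F := by exact_mod_cast Fintype.card_pos
  choose g hg using exists_freq_lineVote_ne_le hq hρ (by nlinarith)
  refine ⟨g, fun x h ↦ ?_, ?_⟩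
  · have h₁ : freq (fun z : V × V ↦ ∃ t ∈ (univ : Finset F),
        lineVote f (x + t • h) (z.1 + t • z.2) ≠ g (x + t • h)) ≤ Fintype.card F * (8 * ρ) :=
      freq_exists_le_mul univ _ fun t _ ↦ by
        refine le_of_eq_of_le ?_ (hg (x + t • h))
        rw [← freq_pair_affine_single (b₁ := (1 : F)) (b₂ := t) (by simp) 0
          fun k ↦ lineVote f (x + t • h) k ≠ g (x + t • h)]
        simp
    have h₂ : freq (fun z : V × V ↦ ∃ s ∈ univ.erase (0 : F),
        ¬ IsLowDegreeOn d f univ (x + s • z.1) (h + s • z.2)) ≤ Fintype.card F * ρ :=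
      (freq_exists_le_mul _ _ fun s hs ↦ by
        refine le_of_eq_of_le ?_ hρ
        rw [← freq_pair_affine (a₁ := s) (a₂ := 0) (b₁ := 0) (b₂ := s)
          (by simpa using hs) x h fun a b ↦ ¬ IsLowDegreeOn d f univ a b]
        simp).trans (mul_le_mul_of_nonneg_right
          (by exact_mod_cast card_le_univ _) hρ0)
    obtain ⟨z, hz⟩ := exists_not_of_freq_lt_one
      (((freq_or_le _ _).trans (add_le_add h₁ h₂)).trans_lt (by linarith))
    push Not at hz
    choose! R hR hRf using hz.2
    refine ⟨-∑ s ∈ univ.erase 0, R s, ?_, fun t _ ↦ ?_⟩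
    · rw [natDegree_neg]
      exact natDegree_sum_le_of_forall_le _ _ fun s hs ↦ hR s hs
    · rw [← hz.1 t (mem_univ t), lineVote, eval_neg, eval_finsetSum]
      refine congrArg _ (sum_congr rfl fun s hs ↦ ?_)
      rw [hRf s hs t (mem_univ t)]
      refine congrArg f ?_
      module
  · have h₁ : freq (fun z : V × V ↦ lineVote f z.1 z.2 ≠ g z.1) ≤ 8 * ρ := by
      rw [freq_prod]
      exact expect_le univ_nonempty fun x _ ↦ hg x
    calc freq (fun x ↦ f x ≠ g x) = freq fun z : V × V ↦ f z.1 ≠ g z.1 :=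
          (freq_fst _).symm
      _ ≤ freq (fun z : V × V ↦
            ¬ IsLowDegreeOn d f univ z.1 z.2 ∨ lineVote f z.1 z.2 ≠ g z.1) :=
          freq_mono fun z hz ↦ by
            by_contra! hcon
            exact hz (by rw [← hcon.2, hcon.1.lineVote_eq hq])
      _ ≤ 9 * ρ := (freq_or_le _ _).trans (by linarith)

end SmallField

section Binomial

lemma not_dvd_choose_iff_lucas {p : ℕ} (hp : p.Prime) (a b : ℕ) :
    ¬ p ∣ a.choose b ↔ ¬ p ∣ (a % p).choose (b % p) ∧ ¬ p ∣ (a / p).choose (b / p) := by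
  have := Fact.mk hp
  rw [Choose.choose_modEq_choose_mod_mul_choose_div_nat.dvd_iff dvd_rfl, hp.dvd_mul, not_or]

lemma not_dvd_choose_of_lt {p a b : ℕ} (hp : p.Prime) (ha : a < p) (hb : b ≤ a) :
    ¬ p ∣ a.choose b := fun h ↦ by
  have h₁ : p ∣ a.factorial := by
    rw [← Nat.choose_mul_factorial_mul_factorial hb, mul_assoc]
    exact h.mul_right _
  exact ha.not_ge (hp.dvd_factorial.1 h₁)

lemma le_of_not_dvd_choose {p a b : ℕ} (h : ¬ p ∣ a.choose b) : b ≤ a := by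
  by_contra! hlt
  exact h (by simp [Nat.choose_eq_zero_of_lt hlt])

/-- A binomial coefficient prime to `p` whose lower index is not maximal stays prime to `p` after
increasing the lower index by a suitable power of `p`. -/
lemma exists_not_dvd_choose_add_pow {p : ℕ} (hp : p.Prime) {s a b : ℕ} (ha : a < p ^ s)
    (hb : b < a) (h : ¬ p ∣ a.choose b) : ∃ j < s, ¬ p ∣ a.choose (b + p ^ j) := by
  induction s generalizing a b with
  | zero => simp at ha; omega
  | succ s ih =>
    obtain ⟨h₁, h₂⟩ := (not_dvd_choose_iff_lucas hp a b).1 h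
    have hap : a % p < p := Nat.mod_lt _ hp.pos
    rcases (le_of_not_dvd_choose h₁).lt_or_eq with hlt | heq
    · refine ⟨0, s.succ_pos, (not_dvd_choose_iff_lucas hp _ _).2 ?_⟩
      have hmod : (b + 1) % p = b % p + 1 := by
        rw [Nat.add_mod, Nat.mod_eq_of_lt (a := 1) hp.one_lt, Nat.mod_eq_of_lt (by omega)]
      have hdiv : (b + 1) / p = b / p := by
        have e₁ := Nat.div_add_mod (b + 1) p
        have e₂ := Nat.div_add_mod b p
        rw [hmod] at e₁
        exact Nat.eq_of_mul_eq_mul_left hp.pos (by omega)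
      rw [pow_zero, hmod, hdiv]
      exact ⟨not_dvd_choose_of_lt hp hap hlt, h₂⟩
    · have hlt : b / p < a / p := by
        refine (le_of_not_dvd_choose h₂).lt_of_ne fun hne ↦ hb.ne ?_
        rw [← Nat.div_add_mod b p, ← Nat.div_add_mod a p, hne, heq]
      obtain ⟨j, hj, hjc⟩ := ih (Nat.div_lt_of_lt_mul (by rwa [← pow_succ'])) hlt h₂
      refine ⟨j + 1, Nat.succ_lt_succ hj, (not_dvd_choose_iff_lucas hp _ _).2 ?_⟩
      rw [pow_succ', Nat.add_mul_mod_self_left, Nat.add_mul_div_left _ _ hp.pos]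
      exact ⟨h₁, hjc⟩

/-- A multi-index of size more than `d` dominates, with nonvanishing binomial coefficients
modulo `p`, a multi-index whose size exceeds `d` by at most the largest carry. -/
lemma exists_multiindex_not_dvd_choose {σ : Type*} [Fintype σ] {p s d : ℕ} (hp : p.Prime)
    {a : σ → ℕ} (ha : ∀ i, a i < p ^ (s + 1)) (hd : d < ∑ i, a i) :
    ∃ b : σ → ℕ, (∀ i, ¬ p ∣ (a i).choose (b i)) ∧ d < ∑ i, b i ∧ ∑ i, b i ≤ d + p ^ s := by
  classical
  have key : ∀ n ≤ d + 1, ∃ b : σ → ℕ, (∀ i, ¬ p ∣ (a i).choose (b i)) ∧ n ≤ ∑ i, b i ∧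
      ∑ i, b i ≤ d + p ^ s := by
    intro n
    induction n with
    | zero => exact fun _ ↦ ⟨0, fun i ↦ by simpa using hp.ne_one, by simp, by simp⟩
    | succ n ih =>
      intro hn
      obtain ⟨b, hb, hnb, hbd⟩ := ih (by omega)
      rcases hnb.lt_or_eq with hlt | heq
      · exact ⟨b, hb, hlt, hbd⟩
      · obtain ⟨i, -, hi⟩ := exists_lt_of_sum_lt (s := univ) (f := b) (g := a) (by omega)
        obtain ⟨j, hj, hjc⟩ := exists_not_dvd_choose_add_pow hp (ha i) hi (hb i)
        have hsum : ∑ k, (b + Pi.single i (p ^ j) : σ → ℕ) k = n + p ^ j := by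
          simp [sum_add_distrib, heq]
        have hpj : 1 ≤ p ^ j := Nat.one_le_pow _ _ hp.pos
        have hpj' : p ^ j ≤ p ^ s := Nat.pow_le_pow_right hp.pos (by omega)
        refine ⟨b + Pi.single i (p ^ j), fun k ↦ ?_, by omega, by omega⟩
        by_cases hk : k = i
        · subst hk
          simpa using hjc
        · simpa [hk] using hb k
  obtain ⟨b, hb, h₁, h₂⟩ := key (d + 1) le_rfl
  exact ⟨b, hb, h₁, h₂⟩

end Binomial

section Characterization

universe u

variable {F σ : Type u} [Field F] [Fintype σ]

open MvPolynomial

lemma add_smul_pow_eq_sum [DecidableEq σ] (α : σ → ℕ) (x h : σ → F) (t : F) :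
    ∏ i, (x + t • h) i ^ α i = ∑ b ∈ Fintype.piFinset fun i ↦ range (α i + 1),
      (∏ i, ((α i).choose (b i) : F)) * t ^ (∑ i, b i) *
        ((∏ i, x i ^ (α i - b i)) * ∏ i, h i ^ b i) := by
  calc _ = ∏ i, ∑ j ∈ range (α i + 1), (t * h i) ^ j * x i ^ (α i - j) * (α i).choose j := by
        refine prod_congr rfl fun i _ ↦ ?_
        rw [← add_pow, Pi.add_apply, Pi.smul_apply, smul_eq_mul, add_comm]
    _ = _ := by
        rw [prod_univ_sum]
        refine sum_congr rfl fun b _ ↦ ?_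
        rw [← prod_pow_eq_pow_sum]
        simp only [← prod_mul_distrib]
        exact prod_congr rfl fun i _ ↦ by ring

variable [Fintype F]

/-- If a weighted power sum of a reduced polynomial vanishes over every line, then so do certain
multiples of its coefficients by binomial coefficients. -/
lemma coeff_mul_prod_choose_eq_zero {p : MvPolynomial σ F}
    (hp : p ∈ restrictDegree σ F (Fintype.card F - 1)) {b : σ → ℕ}
    (hb : ∑ i, b i ≤ Fintype.card F - 1)
    (hsum : ∀ x h : σ → F,
      ∑ t : F, t ^ (Fintype.card F - 1 - ∑ i, b i) * eval (x + t • h) p = 0)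
    {α : σ →₀ ℕ} (hα : ∀ i, b i ≤ α i) :
    coeff α p * ∏ i, ((α i).choose (b i) : F) = 0 := by
  classical
  by_cases hαp : α ∈ p.support
  swap
  · rw [notMem_support_iff.1 hαp, zero_mul]
  set e := Fintype.card F - 1 - ∑ i, b i with he
  set s : (σ →₀ ℕ) → (σ → ℕ) → (σ ⊕ σ →₀ ℕ) := fun α c ↦
    Finsupp.equivFunOnFinite.symm (Sum.elim (fun i ↦ α i - c i) c) with hs
  set A : (σ →₀ ℕ) → (σ → ℕ) → F := fun α c ↦
    coeff α p * (∏ i, ((α i).choose (c i) : F)) * ∑ t : F, t ^ (e + ∑ i, c i) with hA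
  set I : (σ →₀ ℕ) → Finset (σ → ℕ) := fun α ↦ Fintype.piFinset fun i ↦ range (α i + 1)
  set Q : MvPolynomial (σ ⊕ σ) F :=
    ∑ α ∈ p.support, ∑ c ∈ I α, monomial (s α c) (A α c) with hQ
  have hQ0 : Q = 0 := by
    refine eq_zero_of_eval_eq_zero _ _ Q (fun v ↦ ?_) ?_
    · rw [← hsum (fun i ↦ v (.inl i)) fun i ↦ v (.inr i)]
      simp only [eval_eq' _ p, mul_sum, hQ, map_sum]
      rw [sum_comm]
      refine sum_congr rfl fun α _ ↦ ?_
      simp only [add_smul_pow_eq_sum, mul_sum]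
      rw [sum_comm]
      refine sum_congr rfl fun c _ ↦ ?_
      rw [eval_monomial, Finsupp.prod_fintype _ _ fun _ ↦ pow_zero _, Fintype.prod_sum_type]
      simp only [hs, hA, Finsupp.equivFunOnFinite_symm_apply_apply, Sum.elim_inl, Sum.elim_inr,
        mul_sum, sum_mul]
      refine sum_congr rfl fun t _ ↦ ?_
      rw [pow_add]
      ring
    · refine Submodule.sum_mem _ fun α hα ↦ Submodule.sum_mem _ fun c hc ↦ ?_
      rw [mem_restrictDegree] at hp ⊢
      intro r hr i
      rw [mem_singleton.1 (support_monomial_subset hr)]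
      simp only [I, Fintype.mem_piFinset, mem_range] at hc
      rcases i with i | i
      · have := hp α hα i
        simp only [hs, Finsupp.equivFunOnFinite_symm_apply_apply, Sum.elim_inl]
        omega
      · have := hp α hα i
        have := hc i
        simp only [hs, Finsupp.equivFunOnFinite_symm_apply_apply, Sum.elim_inr]
        omega
  have hinj : ∀ α' c, c ∈ I α' → s α' c = s α b → α' = α ∧ c = b := by
    intro α' c hc h
    simp only [hs, EmbeddingLike.apply_eq_iff_eq] at h
    have h₂ : c = b := funext fun i ↦ congrFun h (.inr i)
    refine ⟨Finsupp.ext fun i ↦ ?_, h₂⟩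
    have h₁ : α' i - c i = α i - b i := congrFun h (.inl i)
    simp only [I, Fintype.mem_piFinset, mem_range] at hc
    have := hc i
    have := congrFun h₂ i
    have := hα i
    omega
  have hbI : b ∈ I α := by
    simp only [I, Fintype.mem_piFinset, mem_range]
    exact fun i ↦ Nat.lt_succ_of_le (hα i)
  have hcoeff : coeff (s α b) Q = A α b := by
    simp only [hQ, coeff_sum, coeff_monomial]
    rw [sum_eq_single_of_mem α hαp, sum_eq_single_of_mem b hbI, if_pos rfl]
    · exact fun c hc hcb ↦ if_neg fun h ↦ hcb (hinj α c hc h).2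
    · exact fun α' _ hne ↦ Finset.sum_eq_zero fun c hc ↦
        if_neg fun h ↦ hne (hinj α' c hc h).1
  have hpow : ∑ t : F, t ^ (e + ∑ i, b i) = -1 := by
    have hq := Fintype.one_lt_card (α := F)
    have hsimp : ∀ t : F, t ^ (Fintype.card F - 1) = 1 - if t = 0 then 1 else 0 := fun t ↦ by
      split_ifs with ht
      · rw [ht, zero_pow (by omega), sub_self]
      · rw [FiniteField.pow_card_sub_one_eq_one t ht, sub_zero]
    rw [he, Nat.sub_add_cancel hb]
    simp [hsimp]
  simp only [hQ0, coeff_zero, hA, hpow] at hcoeff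
  linear_combination hcoeff

/-- Over a field of order `p ^ s`, a function of degree at most `d` on every line, where
`d + p ^ (s - 1) < p ^ s`, is a polynomial of total degree at most `d`. -/
lemma exists_totalDegree_le_of_isLowDegreeOn {d : ℕ} {g : (σ → F) → F}
    (hg : ∀ x h, IsLowDegreeOn d g univ x h)
    (hd : d + Fintype.card F / ringChar F + 1 ≤ Fintype.card F) :
    ∃ p : MvPolynomial σ F, p.totalDegree ≤ d ∧ ∀ y, eval y p = g y := by
  obtain ⟨p, hp, hpg⟩ : ∃ p ∈ restrictDegree σ F (Fintype.card F - 1), evalₗ F σ p = g := by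
    rw [← Submodule.mem_map, map_restrict_dom_evalₗ]
    trivial
  have hpg' : ∀ y, eval y p = g y := fun y ↦ by rw [← hpg, evalₗ_apply]
  refine ⟨p, Finset.sup_le fun α hα ↦ ?_, hpg'⟩
  rw [Finsupp.sum_fintype _ _ fun _ ↦ rfl]
  by_contra! hlt
  obtain ⟨n, hprime, hcard⟩ := FiniteField.card F (ringChar F)
  obtain ⟨s, hs⟩ : ∃ s, (n : ℕ) = s + 1 := ⟨n - 1, (Nat.succ_pred_eq_of_pos n.pos).symm⟩
  rw [hs] at hcard
  have hdiv : Fintype.card F / ringChar F = ringChar F ^ s := by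
    rw [hcard, pow_succ, Nat.mul_div_cancel _ hprime.pos]
  rw [hdiv] at hd
  obtain ⟨b, hb, hdb, hbd⟩ := exists_multiindex_not_dvd_choose (s := s) hprime (a := α)
    (fun i ↦ by
      have := (mem_restrictDegree _ _ _).1 hp α hα i
      omega) hlt
  have hzero := coeff_mul_prod_choose_eq_zero hp (b := b) (by omega) (fun x h ↦ by
    obtain ⟨R, hR, hRg⟩ := hg x h
    have hdeg : (Polynomial.X ^ (Fintype.card F - 1 - ∑ i, b i) * R).natDegree ≤
        Fintype.card F - 2 := by
      refine Polynomial.natDegree_mul_le.trans ?_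
      rw [Polynomial.natDegree_X_pow]
      omega
    have := IsLowDegreeOn.sum_eq_zero (d := Fintype.card F - 2) (V := F)
      (f := fun t ↦ t ^ (Fintype.card F - 1 - ∑ i, b i) * eval (x + t • h) p) (by omega)
      (x := 0) (h := 1) ⟨_, hdeg, fun t ht ↦ by simp [hRg t ht, hpg']⟩
    simpa using this) fun i ↦ le_of_not_dvd_choose (hb i)
  rcases mul_eq_zero.1 hzero with h | h
  · exact (mem_support_iff.1 hα) h
  · obtain ⟨i, -, hi⟩ := prod_eq_zero_iff.1 h
    exact hb i ((ringChar.spec F _).1 hi)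

end Characterization

lemma expect_freq_eq_freq_prod {F V : Type*} [Fintype F] [Fintype V] (p : V → V → F → Prop) :
    𝔼 t : F, freq (fun z : V × V ↦ p z.1 z.2 t) = freq fun z : V × V × F ↦ p z.1 z.2.1 z.2.2 := by
  rw [← freq_prod' fun z : (V × V) × F ↦ p z.1.1 z.1.2 z.2]
  exact Fintype.expect_equiv (Equiv.prodAssoc V V F) _ _ fun _ ↦ rfl

universe u in
/-- The low-degree test: a function which the test rejects with small probability `δ` is within
distance `2 * δ` of a polynomial of low total degree. -/
lemma exists_totalDegree_le_of_freq_ne_le {F σ : Type u} [Field F] [Fintype F] [Fintype σ]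
    [DecidableEq σ] {d : ℕ} (hd : d + Fintype.card F / ringChar F + 1 ≤ Fintype.card F) {δ : ℝ}
    (hδd : 200 * (d + 1) ^ 2 * δ ≤ 1) {f : (σ → F) → F}
    {P : (σ → F) → (σ → F) → Polynomial F} (hP : ∀ x h, (P x h).natDegree ≤ d)
    (hδ : freq (fun z : (σ → F) × (σ → F) × F ↦
      (P z.1 z.2.1).eval z.2.2 ≠ f (z.1 + z.2.2 • z.2.1)) ≤ δ) :
    ∃ p : MvPolynomial σ F, p.totalDegree ≤ d ∧
      freq (fun x ↦ f x ≠ MvPolynomial.eval x p) ≤ 2 * δ := by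
  classical
  have hq : d + 2 ≤ Fintype.card F := by
    have hp : 0 < Fintype.card F / ringChar F :=
      Nat.div_pos (Nat.le_of_dvd Fintype.card_pos
        ((ringChar.spec F _).1 (FiniteField.cast_card_eq_zero F)))
        (CharP.ringChar_ne_zero_of_finite F).bot_lt
    omega
  have hd0 : (0 : ℝ) ≤ d := d.cast_nonneg
  have hq' : (d : ℝ) + 2 ≤ Fintype.card F := by exact_mod_cast hq
  have hδ0 : 0 ≤ δ := (freq_nonneg _).trans hδ
  rw [← expect_freq_eq_freq_prod fun x h t ↦ (P x h).eval t ≠ f (x + t • h)] at hδ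
  obtain ⟨g, hg, hfg⟩ : ∃ g : (σ → F) → F,
      (∀ x h, IsLowDegreeOn d g univ x h) ∧
      8 * Fintype.card F * freq (fun x ↦ f x ≠ g x) ≤ Fintype.card F - d := by
    rcases le_total (2 * (d + 1)) (Fintype.card F) with hlarge | hsmall
    · obtain ⟨g, hg, hfg⟩ :=
        exists_isLowDegreeOn_of_large_card hP hlarge hδ hδd
      have hlarge' : 2 * ((d : ℝ) + 1) ≤ Fintype.card F := by exact_mod_cast hlarge
      exact ⟨g, hg, by nlinarith⟩
    · have hsmall' : (Fintype.card F : ℝ) ≤ 2 * (d + 1) := by exact_mod_cast hsmall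
      have hqδ : Fintype.card F * (Fintype.card F * δ) ≤ 4 / 200 := by
        have : (Fintype.card F : ℝ) ^ 2 ≤ (2 * (d + 1)) ^ 2 := by gcongr
        nlinarith
      obtain ⟨g, hg, hfg⟩ := exists_isLowDegreeOn_of_freq_le hq
        (freq_not_isLowDegreeOn_le hP hδ univ)
        (by rw [card_univ]; linarith)
      rw [card_univ] at hfg
      exact ⟨g, hg, by nlinarith⟩
  obtain ⟨p, hp, hpg⟩ := exists_totalDegree_le_of_isLowDegreeOn hg hd
  refine ⟨p, hp, ?_⟩
  simp only [hpg]
  exact freq_ne_le_two_mul hP hδ hg hq hfg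

end LowDegreeTest

/-- There is a constant `c > 0` such that for any finite field `F` of
order `q` and characteristic `p` with `q - q/p - 1 ≥ d` (stated additively), any
`0 ≤ δ ≤ 1/(c(d+1)²)`, any `f : F^m → F` and any family `P` of univariate polynomials
of degree at most `d` indexed by pairs `(x,h)`: if the fraction of triples `(x,h,t)`
with `P_{x,h}(t) ≠ f(x + t·h)` is at most `δ`, then `f` is within distance `2δ` of the
evaluation of some polynomial of total degree at most `d`. -/
theorem low_degree_test_small_field :
    ∃ c : ℝ, 0 < c ∧
    ∀ (F : Type) [Field F] [Fintype F] [DecidableEq F] (m d : ℕ), 1 ≤ m →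
      d + Fintype.card F / ringChar F + 1 ≤ Fintype.card F →
      ∀ δ : ℝ, 0 ≤ δ → δ ≤ 1 / (c * ((d : ℝ) + 1) ^ 2) →
      ∀ (f : (Fin m → F) → F)
        (P : (Fin m → F) → (Fin m → F) → Polynomial F),
        (∀ x h : Fin m → F, (P x h).natDegree ≤ d) →
        ((Finset.univ.filter fun z : (Fin m → F) × (Fin m → F) × F =>
            (P z.1 z.2.1).eval z.2.2 ≠ f (z.1 + z.2.2 • z.2.1)).card : ℝ) /
          (Fintype.card F : ℝ) ^ (2 * m + 1) ≤ δ →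
      ∃ g : (Fin m → F) → F,
        (∃ Pg : MvPolynomial (Fin m) F, Pg.totalDegree ≤ d ∧
          ∀ y : Fin m → F, MvPolynomial.eval y Pg = g y) ∧
        ((Finset.univ.filter fun x : Fin m → F => f x ≠ g x).card : ℝ) /
          (Fintype.card F : ℝ) ^ m ≤ 2 * δ := by
  refine ⟨200, by norm_num, ?_⟩
  intro F _ _ _ m d _ hd δ _ hδ f P hP hreject
  obtain ⟨p, hp, hfp⟩ := LowDegreeTest.exists_totalDegree_le_of_freq_ne_le hd (f := f) (δ := δ)
    (by rw [le_div_iff₀ (by positivity)] at hδ; linarith) hP (by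
      rw [LowDegreeTest.freq_eq_card_div]
      convert hreject using 2
      simp only [Fintype.card_prod, Fintype.card_pi, Finset.prod_const, Finset.card_univ,
        Fintype.card_fin]
      push_cast
      ring)
  refine ⟨fun y ↦ MvPolynomial.eval y p, ⟨p, hp, fun _ ↦ rfl⟩, ?_⟩
  rw [LowDegreeTest.freq_eq_card_div] at hfp
  simpa [Fintype.card_pi] using hfp
end

section
/- There exists a constant c such that the following holds. Let F be a finite field with |F| ≥ d + 2, let m ≥ 1, and let δ be a real number with 0 ≤ δ ≤ 1/(c(d+1)^2). If f : F^m → F and a family {P_{x,h}} of univariate polynomials over F of degree at most d, indexed by pairs (x,h) ∈ F^m × F^m, satisfy Pr_{x,h,t}[P_{x,h}(t) ≠ f(x + t·h)] ≤ δ, then there exists a function g : F^m → F with d(f,g) ≤ 2δ such that for every x, h ∈ F^m there exists a univariate polynomial of degree at most d agreeing with t ↦ g(x + t·h) at every t ∈ F. -/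
section LowDegreeTest

open Polynomial Finset

/-- The real-valued indicator of a proposition. -/
noncomputable def ind (p : Prop) : ℝ := by
  classical exact if p then 1 else 0

lemma ind_of_true {p : Prop} (hp : p) : ind p = 1 := by simp [ind, hp]

lemma ind_of_false {p : Prop} (hp : ¬p) : ind p = 0 := by simp [ind, hp]

lemma ind_nonneg (p : Prop) : 0 ≤ ind p := by
  unfold ind; split_ifs <;> norm_num

lemma ind_mul_self (p : Prop) : ind p * ind p = ind p := by
  unfold ind; split_ifs <;> norm_num

lemma ind_le_sum {ι : Type*} {p : Prop} {S : Finset ι} {r : ι → Prop}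
    (h : p → ∃ i ∈ S, r i) : ind p ≤ ∑ i ∈ S, ind (r i) := by
  by_cases hp : p
  · obtain ⟨i, hi, hr⟩ := h hp
    rw [ind_of_true hp, ← ind_of_true hr]
    exact single_le_sum (f := fun i => ind (r i)) (fun i _ => ind_nonneg _) hi
  · rw [ind_of_false hp]
    exact sum_nonneg fun i _ => ind_nonneg _

lemma sum_ind_eq_card {ι : Type*} (S : Finset ι) (p : ι → Prop) [DecidablePred p] :
    ∑ i ∈ S, ind (p i) = ((S.filter p).card : ℝ) := by
  rw [card_filter]
  push_cast
  refine sum_congr rfl fun i _ => ?_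
  by_cases h : p i <;> simp [ind, h]

variable {F E : Type*} [Field F] [AddCommGroup E] [Module F E] [Fintype E]

lemma sum_affine (G : E → E → ℝ) (x₀ y₀ : E) {a b c e : F} (h : a * e - b * c ≠ 0) :
    ∑ z : E × E, G (x₀ + a • z.1 + b • z.2) (y₀ + c • z.1 + e • z.2) =
      ∑ z : E × E, G z.1 z.2 := by
  have hinj : Function.Injective
      fun z : E × E => (x₀ + a • z.1 + b • z.2, y₀ + c • z.1 + e • z.2) := by
    rintro ⟨u, v⟩ ⟨u', v'⟩ huv
    simp only [Prod.mk.injEq] at huv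
    obtain ⟨h1, h2⟩ := huv
    have h1' : a • (u - u') + b • (v - v') = 0 := by
      rw [add_assoc, add_assoc, add_right_inj] at h1
      rw [smul_sub, smul_sub, ← sub_eq_zero.mpr h1]; abel
    have h2' : c • (u - u') + e • (v - v') = 0 := by
      rw [add_assoc, add_assoc, add_right_inj] at h2
      rw [smul_sub, smul_sub, ← sub_eq_zero.mpr h2]; abel
    have hu : (a * e - b * c) • (u - u') = 0 := by
      have : (a * e - b * c) • (u - u') = e • (a • (u - u') + b • (v - v')) -
          b • (c • (u - u') + e • (v - v')) := by module
      rw [this, h1', h2', smul_zero, smul_zero, sub_zero]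
    have hv : (a * e - b * c) • (v - v') = 0 := by
      have : (a * e - b * c) • (v - v') = a • (c • (u - u') + e • (v - v')) -
          c • (a • (u - u') + b • (v - v')) := by module
      rw [this, h1', h2', smul_zero, smul_zero, sub_zero]
    rw [smul_eq_zero_iff_right h, sub_eq_zero] at hu hv
    rw [hu, hv]
  exact (Finite.injective_iff_bijective.mp hinj).sum_comp fun z : E × E => G z.1 z.2

lemma sum_affine_fst (G : E → ℝ) (x₀ : E) {a b : F} (h : a ≠ 0) :
    ∑ z : E × E, G (x₀ + a • z.1 + b • z.2) = Fintype.card E * ∑ x, G x := by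
  have := sum_affine (fun x _ => G x) x₀ 0 (a := a) (b := b) (c := 0) (e := 1) (by simpa using h)
  rw [this, Fintype.sum_prod_type, mul_sum]
  simp

lemma exists_forall_eval_zero {T : Finset F} :
    ∃ w : F → F, ∀ R : F[X], R.natDegree < T.card →
      R.eval 0 = ∑ t ∈ T, w t * R.eval t := by
  classical
  refine ⟨fun t => (Lagrange.basis T id t).eval 0, fun R hR => ?_⟩
  have hdeg : R.degree < T.card := lt_of_le_of_lt degree_le_natDegree (by exact_mod_cast hR)
  have := Lagrange.eq_interpolate (s := T) (v := id) (f := R) (fun _ _ _ _ h => h) hdeg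
  conv_lhs => rw [this]
  simp [Lagrange.interpolate_apply, eval_finsetSum, mul_comm]


/-- The weighted sum predicting `f x` from the values of `f` at the points `x + t • h`, `t ∈ T`. -/
def extrap (w : F → F) (T : Finset F) (f : E → F) (x h : E) : F :=
  ∑ t ∈ T, w t * f (x + t • h)

/-- The values of `f` at the points `y + t • h`, `t ∈ S`, are those of a polynomial of degree at
most `d`. -/
def Fits (d : ℕ) (f : E → F) (S : Finset F) (y h : E) : Prop :=
  ∃ R : F[X], R.natDegree ≤ d ∧ ∀ t ∈ S, R.eval t = f (y + t • h)

/-- The polynomial attached to the reparametrised line `(y + r • h, h)` disagrees with `f` at the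
point `y + u • h`. -/
def Disagrees (P : E → E → F[X]) (f : E → F) (y h : E) (r u : F) : Prop :=
  (P (y + r • h) h).eval (u - r) ≠ f (y + u • h)

lemma natDegree_comp_affine_le {R : F[X]} {d : ℕ} (hR : R.natDegree ≤ d) (a b : F) :
    (R.comp (C a * X + C b)).natDegree ≤ d := by
  refine natDegree_comp_le.trans ?_
  have : (C a * X + C b).natDegree ≤ 1 := natDegree_linear_le
  nlinarith

variable {d : ℕ} {f : E → F} {P : E → E → F[X]} {δ : ℝ}

omit [Fintype E] in
lemma fits_of_forall_not_disagrees (hP : ∀ x h, (P x h).natDegree ≤ d) {S : Finset F} {y h : E}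
    {r : F} (hS : ∀ u ∈ S, ¬Disagrees P f y h r u) : Fits d f S y h := by
  refine ⟨(P (y + r • h) h).comp (C 1 * X + C (-r)), natDegree_comp_affine_le (hP _ _) _ _,
    fun t ht => ?_⟩
  have := hS t ht
  rw [Disagrees, not_not] at this
  rw [← this]
  simp [sub_eq_add_neg]

omit [Fintype E] in
lemma extrap_eq_of_fits {w : F → F} {T : Finset F} (hT : T.card = d + 1)
    (hw : ∀ R : F[X], R.natDegree < T.card → R.eval 0 = ∑ t ∈ T, w t * R.eval t)
    [DecidableEq F] {x h : E} (hfit : Fits d f (insert 0 T) x h) : extrap w T f x h = f x := by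
  obtain ⟨R, hR, hRf⟩ := hfit
  have h0 := hRf 0 (mem_insert_self _ _)
  rw [zero_smul, add_zero] at h0
  rw [← h0, hw R (by omega), extrap]
  exact sum_congr rfl fun t ht => by rw [hRf t (mem_insert_of_mem ht)]

variable [Fintype F]

lemma sum_disagrees (u : F) :
    ∑ z : E × E, ∑ r, ind (Disagrees P f z.1 z.2 r u) =
      ∑ z : E × E, ∑ t, ind ((P z.1 z.2).eval t ≠ f (z.1 + t • z.2)) := by
  rw [sum_comm, sum_comm (s := univ) (t := (univ : Finset F))]
  have key (r : F) : ∑ z : E × E, ind (Disagrees P f z.1 z.2 r u) =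
      ∑ z : E × E, ind ((P z.1 z.2).eval (u - r) ≠ f (z.1 + (u - r) • z.2)) := by
    rw [← sum_affine (fun y h => ind ((P y h).eval (u - r) ≠ f (y + (u - r) • h)))
      0 0 (a := 1) (b := r) (c := 0) (e := 1) (by simp)]
    refine sum_congr rfl fun z _ => ?_
    have : z.1 + r • z.2 + (u - r) • z.2 = z.1 + u • z.2 := by module
    simp [Disagrees, this]
  simp_rw [key]
  exact (Equiv.subLeft u).sum_comp
    fun t => ∑ z : E × E, ind ((P z.1 z.2).eval t ≠ f (z.1 + t • z.2))

lemma sum_not_fits_le (hP : ∀ x h, (P x h).natDegree ≤ d)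
    (hδ : ∀ u, ∑ z : E × E, ∑ r, ind (Disagrees P f z.1 z.2 r u) ≤
      δ * Fintype.card F * Fintype.card E ^ 2) (S : Finset F) :
    ∑ z : E × E, ind (¬Fits d f S z.1 z.2) ≤ S.card * δ * Fintype.card E ^ 2 := by
  have hq : (0 : ℝ) < Fintype.card F := by exact_mod_cast Fintype.card_pos
  refine le_of_mul_le_mul_left ?_ hq
  calc (Fintype.card F : ℝ) * ∑ z : E × E, ind (¬Fits d f S z.1 z.2)
      = ∑ z : E × E, ∑ _r : F, ind (¬Fits d f S z.1 z.2) := by simp [mul_sum]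
    _ ≤ ∑ z : E × E, ∑ r, ∑ u ∈ S, ind (Disagrees P f z.1 z.2 r u) := by
        refine sum_le_sum fun z _ => sum_le_sum fun r _ => ind_le_sum fun h => ?_
        by_contra! hcon
        exact h (fits_of_forall_not_disagrees hP fun u hu => hcon u hu)
    _ = ∑ u ∈ S, ∑ z : E × E, ∑ r, ind (Disagrees P f z.1 z.2 r u) := by
        exact (sum_congr rfl fun z _ => sum_comm).trans sum_comm
    _ ≤ ∑ u ∈ S, δ * Fintype.card F * Fintype.card E ^ 2 := sum_le_sum fun u _ => hδ u
    _ = _ := by simp; ring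

lemma sum_extrap_ne_le (hP : ∀ x h, (P x h).natDegree ≤ d)
    (hδ : ∀ u, ∑ z : E × E, ∑ r, ind (Disagrees P f z.1 z.2 r u) ≤
      δ * Fintype.card F * Fintype.card E ^ 2)
    {w : F → F} {T : Finset F} (hT : T.card = d + 1) (hT0 : 0 ∉ T)
    (hw : ∀ R : F[X], R.natDegree < T.card → R.eval 0 = ∑ t ∈ T, w t * R.eval t) :
    ∑ z : E × E, ind (extrap w T f z.1 z.2 ≠ f z.1) ≤ (d + 2) * δ * Fintype.card E ^ 2 := by
  classical
  have hcard : ((insert 0 T).card : ℝ) = d + 2 := by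
    rw [card_insert_of_notMem hT0, hT]; push_cast; ring
  rw [← hcard]
  refine le_trans (sum_le_sum fun z _ => ?_) (sum_not_fits_le hP hδ _)
  by_cases h : Fits d f (insert 0 T) z.1 z.2
  · rw [ind_of_false (not_not.mpr (extrap_eq_of_fits hT hw h))]
    exact ind_nonneg _
  · rw [ind_of_true h]
    unfold ind; split_ifs <;> norm_num

omit [Fintype F] [Fintype E] in
/-- If the rows `x + t • h₁ + (·) • h₂` agree with low-degree polynomials where needed, the
extrapolations along a curve through the pencil of lines vary polynomially, hence agree at `x`. -/
lemma exists_bad_of_extrap_ne (hP : ∀ x h, (P x h).natDegree ≤ d)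
    {w : F → F} {T : Finset F} (hT : T.card = d + 1)
    (hw : ∀ R : F[X], R.natDegree < T.card → R.eval 0 = ∑ t ∈ T, w t * R.eval t)
    {x h₁ h₂ : E} {v r : F} (hne : extrap w T f x (h₁ + v • h₂) ≠ extrap w T f x h₂)
    (hrow : ∀ t ∈ T, ¬Disagrees P f (x + t • h₁) h₂ r (t * v)) (s : F) :
    (∃ u ∈ T, extrap w T f (x + u • h₂) (h₁ + (v + s * u) • h₂) ≠ f (x + u • h₂)) ∨
      ∃ u ∈ T, ∃ t ∈ T, Disagrees P f (x + t • h₁) h₂ r (u * (1 + t * s) + t * v) := by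
  by_contra! hcon
  obtain ⟨h1, h2⟩ := hcon
  apply hne
  have hcurve (u t : F) : x + t • h₁ + (u * (1 + t * s) + t * v) • h₂ =
      x + u • h₂ + t • (h₁ + (v + s * u) • h₂) := by module
  let W : F[X] := ∑ t ∈ T, C (w t) *
    (P (x + t • h₁ + r • h₂) h₂).comp (C (1 + t * s) * X + C (t * v - r))
  have hWdeg : W.natDegree ≤ d := natDegree_sum_le_of_forall_le _ _ fun t _ =>
    (natDegree_C_mul_le _ _).trans (natDegree_comp_affine_le (hP _ _) _ _)
  have hW (u : F) (hu : ∀ t ∈ T, ¬Disagrees P f (x + t • h₁) h₂ r (u * (1 + t * s) + t * v)) :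
      W.eval u = extrap w T f (x + u • h₂) (h₁ + (v + s * u) • h₂) := by
    simp only [W, eval_finsetSum, extrap]
    refine sum_congr rfl fun t ht => ?_
    have := hu t ht
    rw [Disagrees, not_not, hcurve] at this
    rw [← this]
    simp only [eval_mul, eval_C, eval_comp, eval_add, eval_X]
    congr 2
    ring
  have hW0 : W.eval 0 = extrap w T f x (h₁ + v • h₂) := by
    have := hW 0 (by simpa using hrow)
    simpa using this
  rw [← hW0, hw W (by omega), extrap]
  refine sum_congr rfl fun u hu => ?_
  rw [hW u fun t ht => h2 u hu t ht, h1 u hu]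

omit [Fintype E] in
lemma card_le_of_extrap_ne (hP : ∀ x h, (P x h).natDegree ≤ d)
    {w : F → F} {T : Finset F} (hT : T.card = d + 1) (hT0 : 0 ∉ T)
    (hw : ∀ R : F[X], R.natDegree < T.card → R.eval 0 = ∑ t ∈ T, w t * R.eval t)
    {x h₁ h₂ : E} {v r : F} (hne : extrap w T f x (h₁ + v • h₂) ≠ extrap w T f x h₂)
    (hrow : ∀ t ∈ T, ¬Disagrees P f (x + t • h₁) h₂ r (t * v)) :
    (Fintype.card F : ℝ) ≤
      ∑ u ∈ T, ∑ v : F, ind (extrap w T f (x + u • h₂) (h₁ + v • h₂) ≠ f (x + u • h₂)) +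
      (d + 1) * ∑ t ∈ T, ∑ a, ind (Disagrees P f (x + t • h₁) h₂ r a) := by
  classical
  have hpt (s : F) : (1 : ℝ) ≤
      ∑ u ∈ T, ind (extrap w T f (x + u • h₂) (h₁ + (v + s * u) • h₂) ≠ f (x + u • h₂)) +
      ∑ u ∈ T, ∑ t ∈ T, ind (Disagrees P f (x + t • h₁) h₂ r (u * (1 + t * s) + t * v)) := by
    have hnn₁ : 0 ≤ ∑ u ∈ T,
        ind (extrap w T f (x + u • h₂) (h₁ + (v + s * u) • h₂) ≠ f (x + u • h₂)) :=
      sum_nonneg fun _ _ => ind_nonneg _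
    have hnn₂ : 0 ≤ ∑ u ∈ T, ∑ t ∈ T,
        ind (Disagrees P f (x + t • h₁) h₂ r (u * (1 + t * s) + t * v)) :=
      sum_nonneg fun _ _ => sum_nonneg fun _ _ => ind_nonneg _
    rcases exists_bad_of_extrap_ne hP hT hw hne hrow s with h | ⟨u, hu, h⟩
    · have := ind_le_sum (p := True) fun _ => h
      rw [ind_of_true trivial] at this
      linarith
    · have := ind_le_sum (p := True) fun _ => h
      rw [ind_of_true trivial] at this
      have := single_le_sum (f := fun u => ∑ t ∈ T,
        ind (Disagrees P f (x + t • h₁) h₂ r (u * (1 + t * s) + t * v)))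
        (fun _ _ => sum_nonneg fun _ _ => ind_nonneg _) hu
      linarith
  have hreindex (g : F → ℝ) {a b : F} (ha : a ≠ 0) : ∑ s, g (b + s * a) = ∑ s, g s :=
    ((Equiv.mulRight₀ a ha).trans (Equiv.addLeft b)).sum_comp g
  have hne0 {t : F} (ht : t ∈ T) : t ≠ 0 := fun h => hT0 (h ▸ ht)
  calc (Fintype.card F : ℝ) = ∑ _s : F, (1 : ℝ) := by simp
    _ ≤ _ := sum_le_sum fun s _ => hpt s
    _ = ∑ u ∈ T, ∑ s : F,
          ind (extrap w T f (x + u • h₂) (h₁ + (v + s * u) • h₂) ≠ f (x + u • h₂)) +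
        ∑ u ∈ T, ∑ t ∈ T, ∑ s,
          ind (Disagrees P f (x + t • h₁) h₂ r (u * (1 + t * s) + t * v)) := by
        rw [sum_add_distrib]
        exact congrArg₂ _ sum_comm (sum_comm.trans (sum_congr rfl fun u _ => sum_comm))
    _ = ∑ u ∈ T, ∑ v : F, ind (extrap w T f (x + u • h₂) (h₁ + v • h₂) ≠ f (x + u • h₂)) +
        ∑ u ∈ T, ∑ t ∈ T, ∑ a, ind (Disagrees P f (x + t • h₁) h₂ r a) := by
        congr 1
        · exact sum_congr rfl fun u hu => hreindex
            (fun v => ind (extrap w T f (x + u • h₂) (h₁ + v • h₂) ≠ f (x + u • h₂))) (hne0 hu)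
        · refine sum_congr rfl fun u hu => sum_congr rfl fun t ht => ?_
          rw [← hreindex (fun a => ind (Disagrees P f (x + t • h₁) h₂ r a)) (b := u + t * v)
            (mul_ne_zero (hne0 hu) (hne0 ht))]
          refine sum_congr rfl fun s _ => ?_
          congr 2
          ring
    _ = _ := by simp [hT]

lemma sum_extrap_not_const_le (hP : ∀ x h, (P x h).natDegree ≤ d)
    (hδ : ∀ u, ∑ z : E × E, ∑ r, ind (Disagrees P f z.1 z.2 r u) ≤
      δ * Fintype.card F * Fintype.card E ^ 2)
    {w : F → F} {T : Finset F} (hT : T.card = d + 1) (hT0 : 0 ∉ T)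
    (hw : ∀ R : F[X], R.natDegree < T.card → R.eval 0 = ∑ t ∈ T, w t * R.eval t) (x : E) :
    ∑ z : E × E, ind (∃ v ∈ T, extrap w T f x (z.1 + v • z.2) ≠ extrap w T f x z.2) ≤
      (d + 1) * (3 * d + 4) * δ * Fintype.card E ^ 2 := by
  have hq : (0 : ℝ) < Fintype.card F := by exact_mod_cast Fintype.card_pos
  have hne0 {t : F} (ht : t ∈ T) : t ≠ 0 := fun h => hT0 (h ▸ ht)
  set q : ℝ := (Fintype.card F : ℝ) with hqdef
  set N : ℝ := (Fintype.card E : ℝ) with hN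
  let A (z : E × E) : ℝ := ∑ u ∈ T, ∑ v : F,
    ind (extrap w T f (x + u • z.2) (z.1 + v • z.2) ≠ f (x + u • z.2))
  let M (z : E × E) (r : F) : ℝ := ∑ t ∈ T, ∑ a, ind (Disagrees P f (x + t • z.1) z.2 r a)
  let K (z : E × E) (r : F) : ℝ := ∑ v ∈ T, ∑ t ∈ T,
    ind (Disagrees P f (x + t • z.1) z.2 r (t * v))
  have hA0 (z) : 0 ≤ A z := sum_nonneg fun _ _ => sum_nonneg fun _ _ => ind_nonneg _
  have hM0 (z r) : 0 ≤ M z r := sum_nonneg fun _ _ => sum_nonneg fun _ _ => ind_nonneg _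
  have hK0 (z r) : 0 ≤ K z r := sum_nonneg fun _ _ => sum_nonneg fun _ _ => ind_nonneg _
  have hpt (z : E × E) (r : F) :
      q * ind (∃ v ∈ T, extrap w T f x (z.1 + v • z.2) ≠ extrap w T f x z.2) ≤
        A z + (d + 1) * M z r + q * K z r := by
    have h1 : 0 ≤ (d + 1) * M z r := mul_nonneg (by positivity) (hM0 z r)
    have h2 : 0 ≤ q * K z r := mul_nonneg hq.le (hK0 z r)
    by_cases h : ∃ v ∈ T, extrap w T f x (z.1 + v • z.2) ≠ extrap w T f x z.2
    · rw [ind_of_true h]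
      obtain ⟨v, hv, hne⟩ := h
      by_cases hrow : ∀ t ∈ T, ¬Disagrees P f (x + t • z.1) z.2 r (t * v)
      · have := card_le_of_extrap_ne hP hT hT0 hw hne hrow
        simp only [A, M] at *
        linarith
      · push Not at hrow
        have h3 := ind_le_sum (p := True) fun _ => hrow
        rw [ind_of_true trivial] at h3
        have h4 := single_le_sum (f := fun v => ∑ t ∈ T,
          ind (Disagrees P f (x + t • z.1) z.2 r (t * v)))
          (fun _ _ => sum_nonneg fun _ _ => ind_nonneg _) hv
        have h5 : q * 1 ≤ q * K z r := mul_le_mul_of_nonneg_left (h3.trans h4) hq.le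
        linarith [hA0 z]
    · rw [ind_of_false h]
      linarith [hA0 z]
  have hA : ∑ z, A z ≤ (d + 1) * q * ((d + 2) * δ * N ^ 2) := by
    calc ∑ z, A z = ∑ u ∈ T, ∑ v : F, ∑ z : E × E,
          ind (extrap w T f (x + u • z.2) (z.1 + v • z.2) ≠ f (x + u • z.2)) :=
          sum_comm.trans (sum_congr rfl fun u _ => sum_comm)
      _ ≤ ∑ u ∈ T, ∑ _v : F, (d + 2) * δ * N ^ 2 := by
          refine sum_le_sum fun u hu => sum_le_sum fun v _ => ?_
          refine le_trans (le_of_eq ?_) (sum_extrap_ne_le hP hδ hT hT0 hw)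
          rw [← sum_affine (fun y h => ind (extrap w T f y h ≠ f y)) x 0
            (a := 0) (b := u) (c := 1) (e := v) (by simpa using hne0 hu)]
          simp
      _ = _ := by simp [hT, hqdef]; ring
  have hrowsum (t : F) (ht : t ∈ T) (a : F) :
      ∑ z : E × E, ∑ r, ind (Disagrees P f (x + t • z.1) z.2 r a) ≤ δ * q * N ^ 2 := by
    refine le_trans (le_of_eq ?_) (hδ a)
    rw [← sum_affine (fun y h => ∑ r, ind (Disagrees P f y h r a)) x 0
      (a := t) (b := 0) (c := 0) (e := 1) (by simpa using hne0 ht)]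
    simp
  have hM : ∑ z, ∑ r, M z r ≤ (d + 1) * q * (δ * q * N ^ 2) := by
    calc ∑ z, ∑ r, M z r = ∑ t ∈ T, ∑ a, ∑ z : E × E, ∑ r,
          ind (Disagrees P f (x + t • z.1) z.2 r a) := by
          rw [sum_congr rfl fun z _ => sum_comm, sum_comm]
          refine sum_congr rfl fun t _ => ?_
          rw [sum_congr rfl fun z _ => sum_comm, sum_comm]
      _ ≤ ∑ t ∈ T, ∑ _a : F, δ * q * N ^ 2 :=
          sum_le_sum fun t ht => sum_le_sum fun a _ => hrowsum t ht a
      _ = _ := by simp [hT, hqdef]; ring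
  have hK : ∑ z, ∑ r, K z r ≤ (d + 1) * (d + 1) * (δ * q * N ^ 2) := by
    calc ∑ z, ∑ r, K z r = ∑ v ∈ T, ∑ t ∈ T, ∑ z : E × E, ∑ r,
          ind (Disagrees P f (x + t • z.1) z.2 r (t * v)) := by
          rw [sum_congr rfl fun z _ => sum_comm, sum_comm]
          refine sum_congr rfl fun t _ => ?_
          rw [sum_congr rfl fun z _ => sum_comm, sum_comm]
      _ ≤ ∑ v ∈ T, ∑ t ∈ T, δ * q * N ^ 2 :=
          sum_le_sum fun v _ => sum_le_sum fun t ht => hrowsum t ht _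
      _ = _ := by simp [hT]; ring
  refine le_of_mul_le_mul_left ?_ (mul_pos hq hq)
  calc q * q * ∑ z : E × E, ind (∃ v ∈ T, extrap w T f x (z.1 + v • z.2) ≠ extrap w T f x z.2)
      = ∑ z : E × E, ∑ _r : F,
          q * ind (∃ v ∈ T, extrap w T f x (z.1 + v • z.2) ≠ extrap w T f x z.2) := by
        simp [mul_sum, hqdef, mul_assoc]
    _ ≤ ∑ z : E × E, ∑ r, (A z + (d + 1) * M z r + q * K z r) :=
        sum_le_sum fun z _ => sum_le_sum fun r _ => hpt z r
    _ = q * ∑ z, A z + (d + 1) * ∑ z, ∑ r, M z r + q * ∑ z, ∑ r, K z r := by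
        simp [sum_add_distrib, mul_sum, hqdef]
    _ ≤ q * ((d + 1) * q * ((d + 2) * δ * N ^ 2)) + (d + 1) * ((d + 1) * q * (δ * q * N ^ 2)) +
          q * ((d + 1) * (d + 1) * (δ * q * N ^ 2)) := by gcongr
    _ = _ := by ring

omit [Fintype F] in
/-- Second moment bound: if a random line of `E` is rarely met by the set `{h | p h}` within the
sample `T` of its points, then that set is smaller by a factor of about `T.card`. -/
lemma card_mul_sum_ind_le {p : E → Prop} {T : Finset F} {ε : ℝ} (hε : ε ≤ 1 / 4)
    (h : ∑ z : E × E, ind (∃ v ∈ T, p (z.1 + v • z.2)) ≤ 2 * ε * Fintype.card E ^ 2) :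
    T.card * ∑ k, ind (p k) ≤ 4 * ε * Fintype.card E := by
  classical
  set N : ℝ := (Fintype.card E : ℝ) with hN
  have hNpos : 0 < N := by
    rw [hN]; exact_mod_cast Fintype.card_pos
  set B := ∑ k, ind (p k) with hB
  have hB0 : 0 ≤ B := sum_nonneg fun _ _ => ind_nonneg _
  let X (z : E × E) : ℝ := ∑ v ∈ T, ind (p (z.1 + v • z.2))
  let I (z : E × E) : ℝ := ind (∃ v ∈ T, p (z.1 + v • z.2))
  have hXI (z) : X z = X z * I z := by
    by_cases hz : ∃ v ∈ T, p (z.1 + v • z.2)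
    · simp [I, ind_of_true hz]
    · have : X z = 0 := sum_eq_zero fun v hv => ind_of_false fun hp => hz ⟨v, hv, hp⟩
      rw [this, zero_mul]
  have hone (v : F) : ∑ z : E × E, ind (p (z.1 + v • z.2)) = N * B := by
    have := sum_affine_fst (F := F) (fun k => ind (p k)) 0 (a := 1) (b := v) one_ne_zero
    simpa using this
  have htwo (v v' : F) : ∑ z : E × E, ind (p (z.1 + v • z.2)) * ind (p (z.1 + v' • z.2)) ≤
      (if v = v' then N * B else 0) + B ^ 2 := by
    split_ifs with hv
    · subst hv
      simp_rw [ind_mul_self]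
      rw [hone]
      nlinarith
    · have := sum_affine (F := F) (fun k k' => ind (p k) * ind (p k')) 0 0
        (a := 1) (b := v) (c := 1) (e := v')
        (by simpa [sub_eq_zero] using fun h => hv (Eq.symm h))
      simp only [zero_add, one_smul] at this
      rw [this, Fintype.sum_prod_type, sq, hB, sum_mul_sum, zero_add]
  have hX : ∑ z, X z = T.card * B * N := by
    rw [sum_comm, sum_congr rfl fun v _ => hone v]
    simp; ring
  have hX2 : ∑ z, X z ^ 2 ≤ N * (T.card * B) + (T.card * B) ^ 2 := by
    calc ∑ z, X z ^ 2 = ∑ v ∈ T, ∑ v' ∈ T, ∑ z : E × E,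
          ind (p (z.1 + v • z.2)) * ind (p (z.1 + v' • z.2)) := by
          simp only [X, sq, sum_mul_sum]
          rw [sum_comm]
          exact sum_congr rfl fun v _ => sum_comm
      _ ≤ ∑ v ∈ T, ∑ v' ∈ T, ((if v = v' then N * B else 0) + B ^ 2) :=
          sum_le_sum fun v _ => sum_le_sum fun v' _ => htwo v v'
      _ = _ := by simp [sum_add_distrib]; ring
  have hI : ∑ z, I z ^ 2 ≤ 2 * ε * N ^ 2 := by simpa [I, sq, ind_mul_self] using h
  have hcs := sum_mul_sq_le_sq_mul_sq univ X I
  rw [← sum_congr rfl fun z _ => hXI z, hX] at hcs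
  set K := T.card * B with hK
  have hK0 : 0 ≤ K := mul_nonneg (Nat.cast_nonneg _) hB0
  have h1 : (K * N) ^ 2 ≤ (N * K + K ^ 2) * (2 * ε * N ^ 2) :=
    hcs.trans (mul_le_mul hX2 hI (sum_nonneg fun _ _ => sq_nonneg _)
      (add_nonneg (mul_nonneg hNpos.le hK0) (sq_nonneg _)))
  have h2 : K ^ 2 ≤ (N * K + K ^ 2) * (2 * ε) :=
    le_of_mul_le_mul_right (by linarith) (pow_pos hNpos 2)
  rcases hK0.eq_or_lt with h0 | hKpos
  · have : 0 ≤ 2 * ε * N ^ 2 := (sum_nonneg fun _ _ => sq_nonneg _).trans hI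
    have : 0 ≤ ε := by
      by_contra! hneg
      nlinarith [pow_pos hNpos 2]
    rw [← h0]; positivity
  · have h3 : K ≤ (N + K) * (2 * ε) := le_of_mul_le_mul_right (by linarith) hKpos
    nlinarith

/-- The self-corrected function: almost every line through `x` extrapolates to the same value. -/
lemma exists_majority (hP : ∀ x h, (P x h).natDegree ≤ d)
    (hδ : ∀ u, ∑ z : E × E, ∑ r, ind (Disagrees P f z.1 z.2 r u) ≤
      δ * Fintype.card F * Fintype.card E ^ 2)
    (hsmall : (d + 1) * (3 * d + 4) * δ ≤ 1 / 4)
    {w : F → F} {T : Finset F} (hT : T.card = d + 1) (hT0 : 0 ∉ T)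
    (hw : ∀ R : F[X], R.natDegree < T.card → R.eval 0 = ∑ t ∈ T, w t * R.eval t) (x : E) :
    ∃ a, ∑ h, ind (extrap w T f x h ≠ a) ≤ 4 * (3 * d + 4) * δ * Fintype.card E := by
  set ε := (d + 1) * (3 * d + 4) * δ with hε
  set N : ℝ := (Fintype.card E : ℝ) with hN
  have hcol := sum_extrap_not_const_le hP hδ hT hT0 hw x
  obtain ⟨v₀, hv₀⟩ : T.Nonempty := card_pos.mp (by omega)
  have hpair : ∑ z : E × E, ind (extrap w T f x z.1 ≠ extrap w T f x z.2) ≤ ε * N ^ 2 := by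
    rw [← sum_affine (fun k k' => ind (extrap w T f x k ≠ extrap w T f x k')) 0 0
      (a := 1) (b := v₀) (c := 0) (e := 1) (by simp)]
    refine le_trans (sum_le_sum fun z _ => ?_) hcol
    have := ind_le_sum (S := {()}) (r := fun _ => ∃ v ∈ T,
      extrap w T f x (z.1 + v • z.2) ≠ extrap w T f x z.2)
      (p := extrap w T f x (z.1 + v₀ • z.2) ≠ extrap w T f x z.2)
      fun h => ⟨(), by simp, v₀, hv₀, h⟩
    simpa using this
  obtain ⟨h₀, -, hh₀⟩ : ∃ h₀ ∈ (univ : Finset E),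
      ∑ k, ind (extrap w T f x k ≠ extrap w T f x h₀) ≤ ε * N := by
    refine exists_le_of_sum_le univ_nonempty ?_
    rw [Fintype.sum_prod_type, sum_comm] at hpair
    refine hpair.trans_eq ?_
    simp [hN]; ring
  refine ⟨extrap w T f x h₀, ?_⟩
  set a := extrap w T f x h₀
  have hmeet : ∑ z : E × E, ind (∃ v ∈ T, extrap w T f x (z.1 + v • z.2) ≠ a) ≤
      2 * ε * N ^ 2 := by
    have hsnd : ∑ z : E × E, ind (extrap w T f x z.2 ≠ a) ≤ ε * N ^ 2 := by
      rw [Fintype.sum_prod_type]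
      simp only [sum_const, card_univ, nsmul_eq_mul, ← hN]
      nlinarith [mul_le_mul_of_nonneg_left hh₀ (Nat.cast_nonneg (α := ℝ) (Fintype.card E))]
    have : ∑ z : E × E, ind (∃ v ∈ T, extrap w T f x (z.1 + v • z.2) ≠ a) ≤
        ∑ z : E × E, (ind (∃ v ∈ T, extrap w T f x (z.1 + v • z.2) ≠ extrap w T f x z.2) +
          ind (extrap w T f x z.2 ≠ a)) := by
      refine sum_le_sum fun z _ => ?_
      by_cases hz : extrap w T f x z.2 = a
      · rw [hz]
        linarith [ind_nonneg (a ≠ a)]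
      · rw [ind_of_true hz]
        have : ind (∃ v ∈ T, extrap w T f x (z.1 + v • z.2) ≠ a) ≤ 1 := by
          unfold ind; split_ifs <;> norm_num
        linarith [ind_nonneg (∃ v ∈ T, extrap w T f x (z.1 + v • z.2) ≠ extrap w T f x z.2)]
    rw [sum_add_distrib] at this
    linarith
  have := card_mul_sum_ind_le (p := fun k => extrap w T f x k ≠ a) hsmall hmeet
  rw [hT] at this
  push_cast at this
  refine le_of_mul_le_mul_left (this.trans_eq ?_) (by positivity : (0 : ℝ) < d + 1)
  rw [hε]; ring

/-- On any `d + 2` points of a line, the self-corrected function has degree at most `d`. -/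
lemma fits_majority (hP : ∀ x h, (P x h).natDegree ≤ d)
    (hδ : ∀ u, ∑ z : E × E, ∑ r, ind (Disagrees P f z.1 z.2 r u) ≤
      δ * Fintype.card F * Fintype.card E ^ 2)
    {w : F → F} {T : Finset F} (hT : T.card = d + 1) (hT0 : 0 ∉ T)
    {g : E → F} {μ : ℝ} (hg : ∀ x, ∑ h, ind (extrap w T f x h ≠ g x) ≤ μ * Fintype.card E)
    (hsmall : (d + 2) * μ + (d + 1) * (d + 2) * δ < 1)
    {S : Finset F} (hS : S.card = d + 2) (x h : E) : Fits d g S x h := by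
  set N : ℝ := (Fintype.card E : ℝ) with hN
  have hNpos : 0 < N := by
    rw [hN]; exact_mod_cast Fintype.card_pos
  have hne0 {t : F} (ht : t ∈ T) : t ≠ 0 := fun h => hT0 (h ▸ ht)
  obtain ⟨z, h₁, h₂⟩ : ∃ z : E × E,
      (∀ i ∈ S, extrap w T f (x + i • h) (z.1 + i • z.2) = g (x + i • h)) ∧
      ∀ j ∈ T, Fits d f S (x + j • z.1) (h + j • z.2) := by
    by_contra! hcon
    have hpt (z : E × E) : 1 ≤
        ∑ i ∈ S, ind (extrap w T f (x + i • h) (z.1 + i • z.2) ≠ g (x + i • h)) +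
        ∑ j ∈ T, ind (¬Fits d f S (x + j • z.1) (h + j • z.2)) := by
      have hnn₁ : 0 ≤ ∑ i ∈ S,
          ind (extrap w T f (x + i • h) (z.1 + i • z.2) ≠ g (x + i • h)) :=
        sum_nonneg fun _ _ => ind_nonneg _
      have hnn₂ : 0 ≤ ∑ j ∈ T, ind (¬Fits d f S (x + j • z.1) (h + j • z.2)) :=
        sum_nonneg fun _ _ => ind_nonneg _
      by_cases hz : ∀ i ∈ S, extrap w T f (x + i • h) (z.1 + i • z.2) = g (x + i • h)
      · have := ind_le_sum (p := True) fun _ => hcon z hz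
        rw [ind_of_true trivial] at this
        linarith
      · push Not at hz
        have := ind_le_sum (p := True) fun _ => hz
        rw [ind_of_true trivial] at this
        linarith
    have htotal : ∑ _z : E × E, (1 : ℝ) ≤
        ∑ i ∈ S, N * (μ * N) + ∑ j ∈ T, (d + 2) * δ * N ^ 2 := by
      refine (sum_le_sum fun z _ => hpt z).trans ?_
      rw [sum_add_distrib, sum_comm, sum_comm (s := univ) (t := T)]
      refine add_le_add (sum_le_sum fun i _ => ?_) (sum_le_sum fun j hj => ?_)
      · have := sum_affine_fst (F := F)
          (fun k => ind (extrap w T f (x + i • h) k ≠ g (x + i • h))) 0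
          (a := 1) (b := i) one_ne_zero
        simp only [zero_add, one_smul] at this
        rw [this]
        exact mul_le_mul_of_nonneg_left (hg _) hNpos.le
      · have := sum_affine (F := F) (fun k k' => ind (¬Fits d f S k k')) x h
          (a := j) (b := 0) (c := 0) (e := j) (by simpa using hne0 hj)
        simp only [zero_smul, add_zero] at this
        rw [this]
        refine (sum_not_fits_le hP hδ S).trans_eq ?_
        rw [hS]; push_cast; ring
    simp only [sum_const, card_univ, Fintype.card_prod, nsmul_eq_mul, mul_one, hS, hT] at htotal
    push_cast at htotal
    rw [← hN] at htotal
    nlinarith [pow_pos hNpos 2]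
  choose! R hRdeg hR using h₂
  refine ⟨∑ j ∈ T, C (w j) * R j, natDegree_sum_le_of_forall_le _ _ fun j hj =>
    (natDegree_C_mul_le _ _).trans (hRdeg j hj), fun i hi => ?_⟩
  rw [← h₁ i hi, extrap, eval_finsetSum]
  refine sum_congr rfl fun j hj => ?_
  rw [eval_mul, eval_C, hR j hj i hi]
  congr 2
  module

omit [Fintype E] in
lemma fits_univ_of_forall_card (hF : d + 2 ≤ Fintype.card F) {g : E → F} {x h : E}
    (hg : ∀ S : Finset F, S.card = d + 2 → Fits d g S x h) : Fits d g univ x h := by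
  classical
  obtain ⟨S₀, -, hS₀⟩ := exists_subset_card_eq (s := (univ : Finset F)) (n := d + 1)
    (by rw [card_univ]; omega)
  have hins (s : F) (hs : s ∉ S₀) : Fits d g (insert s S₀) x h :=
    hg _ (by rw [card_insert_of_notMem hs, hS₀])
  obtain ⟨s₀, hs₀⟩ : ∃ s₀, s₀ ∉ S₀ := by
    by_contra! hcon
    have := card_le_card fun t (_ : t ∈ univ) => hcon t
    rw [card_univ] at this
    omega
  obtain ⟨R, hR, hRg⟩ := hins s₀ hs₀
  refine ⟨R, hR, fun s _ => ?_⟩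
  by_cases hs : s ∈ S₀
  · exact hRg s (mem_insert_of_mem hs)
  · obtain ⟨R', hR', hRg'⟩ := hins s hs
    have : R = R' := eq_of_natDegree_lt_card_of_eval_eq' R R' S₀
      (fun t ht => by rw [hRg t (mem_insert_of_mem ht), hRg' t (mem_insert_of_mem ht)])
      (by rw [hS₀]; omega)
    rw [this]
    exact hRg' s (mem_insert_self _ _)

lemma sum_ne_majority_le_mul (hP : ∀ x h, (P x h).natDegree ≤ d)
    (hδ : ∀ u, ∑ z : E × E, ∑ r, ind (Disagrees P f z.1 z.2 r u) ≤
      δ * Fintype.card F * Fintype.card E ^ 2)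
    {w : F → F} {T : Finset F} (hT : T.card = d + 1) (hT0 : 0 ∉ T)
    (hw : ∀ R : F[X], R.natDegree < T.card → R.eval 0 = ∑ t ∈ T, w t * R.eval t)
    {g : E → F} {μ : ℝ} (hμ : μ ≤ 1 / 2)
    (hg : ∀ x, ∑ h, ind (extrap w T f x h ≠ g x) ≤ μ * Fintype.card E) :
    ∑ x, ind (f x ≠ g x) ≤ 2 * (d + 2) * δ * Fintype.card E := by
  set N : ℝ := (Fintype.card E : ℝ) with hN
  have hNpos : 0 < N := by
    rw [hN]; exact_mod_cast Fintype.card_pos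
  set B := ∑ x, ind (f x ≠ g x) with hB
  have hB0 : 0 ≤ B := sum_nonneg fun _ _ => ind_nonneg _
  have hpt (x h : E) : ind (f x ≠ g x) ≤ ind (extrap w T f x h ≠ f x) +
      ind (f x ≠ g x) * ind (extrap w T f x h ≠ g x) := by
    unfold ind; split_ifs <;> simp_all
  have hfit := sum_extrap_ne_le hP hδ hT hT0 hw
  rw [Fintype.sum_prod_type] at hfit
  have h1 : N * B ≤ (d + 2) * δ * N ^ 2 + B * (μ * N) := by
    calc N * B = ∑ x, ∑ _h : E, ind (f x ≠ g x) := by simp [mul_sum, hN, hB]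
      _ ≤ ∑ x, ∑ h, (ind (extrap w T f x h ≠ f x) +
          ind (f x ≠ g x) * ind (extrap w T f x h ≠ g x)) :=
          sum_le_sum fun x _ => sum_le_sum fun h _ => hpt x h
      _ = ∑ x, ∑ h, ind (extrap w T f x h ≠ f x) +
          ∑ x, ind (f x ≠ g x) * ∑ h, ind (extrap w T f x h ≠ g x) := by
          simp_rw [sum_add_distrib, mul_sum]
      _ ≤ (d + 2) * δ * N ^ 2 + ∑ x, ind (f x ≠ g x) * (μ * N) :=
          add_le_add hfit (sum_le_sum fun x _ =>
            mul_le_mul_of_nonneg_left (hg x) (ind_nonneg _))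
      _ = _ := by rw [← sum_mul]
  have h2 : B * (μ * N) ≤ B * (1 / 2 * N) := by gcongr
  refine le_of_mul_le_mul_left ?_ hNpos
  linarith

omit [Fintype E] in
lemma line_disagreement_le (hP : ∀ x h, (P x h).natDegree ≤ d) (hF : d + 2 ≤ Fintype.card F)
    {g : E → F} {x h : E} (hg : Fits d g univ x h) :
    2 * ((Fintype.card F : ℝ) - d) * ∑ t : F, ind (f (x + t • h) ≠ g (x + t • h)) ≤
      3 * ((Fintype.card F : ℝ) - d) * ∑ t, ind ((P x h).eval t ≠ f (x + t • h)) +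
      8 * ((∑ t : F, ind (f (x + t • h) ≠ g (x + t • h))) ^ 2 -
        ∑ t : F, ind (f (x + t • h) ≠ g (x + t • h))) := by
  classical
  obtain ⟨G, hG, hGg⟩ := hg
  have hcases : ∑ t, ind ((P x h).eval t ≠ f (x + t • h)) =
        ∑ t : F, ind (f (x + t • h) ≠ g (x + t • h)) ∨
      (Fintype.card F : ℝ) - d ≤ ∑ t, ind ((P x h).eval t ≠ f (x + t • h)) +
        ∑ t : F, ind (f (x + t • h) ≠ g (x + t • h)) := by
    by_cases hPG : P x h = G
    · left
      refine sum_congr rfl fun t _ => ?_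
      rw [hPG, hGg t (mem_univ _), ne_comm]
    · right
      have hzero : ∑ t, ind ((P x h).eval t = G.eval t) ≤ d := by
        rw [sum_ind_eq_card]
        by_contra! hcon
        refine hPG (eq_of_natDegree_lt_card_of_eval_eq' _ _
          (univ.filter fun t => (P x h).eval t = G.eval t) (fun t ht => (mem_filter.mp ht).2) ?_)
        exact lt_of_le_of_lt (max_le (hP x h) hG) (by exact_mod_cast hcon)
      have hpt (t : F) : 1 ≤ ind ((P x h).eval t = G.eval t) +
          (ind ((P x h).eval t ≠ f (x + t • h)) + ind (f (x + t • h) ≠ g (x + t • h))) := by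
        rw [hGg t (mem_univ _)]
        unfold ind; split_ifs <;> simp_all
      have := sum_le_sum fun t (_ : t ∈ univ) => hpt t
      simp only [sum_add_distrib, sum_const, card_univ, nsmul_eq_mul, mul_one] at this
      linarith
  have hk : (2 : ℝ) ≤ (Fintype.card F : ℝ) - d := by
    have : ((d + 2 : ℕ) : ℝ) ≤ Fintype.card F := by exact_mod_cast hF
    push_cast at this
    linarith
  simp only [sum_ind_eq_card] at hcases ⊢
  generalize (Fintype.card F : ℝ) - d = k at *
  generalize (univ.filter fun t => (P x h).eval t ≠ f (x + t • h)).card = a at *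
  generalize (univ.filter fun t : F => f (x + t • h) ≠ g (x + t • h)).card = b at *
  have hb : (b : ℝ) ≤ (b : ℝ) ^ 2 := by exact_mod_cast Nat.le_self_pow two_ne_zero b
  have ha : (0 : ℝ) ≤ a := Nat.cast_nonneg a
  by_cases hab : 2 * (b : ℝ) ≤ 3 * a
  · nlinarith
  · push Not at hab
    rcases hcases with hcase | hcase
    · linarith
    · have hb1 : (1 : ℝ) < b := by linarith
      have hb2 : (2 : ℝ) ≤ b := by exact_mod_cast (by exact_mod_cast hb1 : 1 < b)
      nlinarith

/-- Pairwise independence of the points of a random line amplifies a crude distance bound. -/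
lemma sum_ne_le_two_mul (hP : ∀ x h, (P x h).natDegree ≤ d) (hF : d + 2 ≤ Fintype.card F)
    (hδ : ∑ z : E × E, ∑ t, ind ((P z.1 z.2).eval t ≠ f (z.1 + t • z.2)) ≤
      δ * Fintype.card F * Fintype.card E ^ 2) (hδ0 : 0 ≤ δ)
    {g : E → F} (hg : ∀ x h, Fits d g univ x h)
    (hcrude : ∑ x, ind (f x ≠ g x) ≤ 2 * (d + 2) * δ * Fintype.card E)
    (hsmall : 16 * (d + 2) ^ 2 * δ ≤ 1) :
    ∑ x, ind (f x ≠ g x) ≤ 2 * δ * Fintype.card E := by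
  classical
  set q : ℝ := (Fintype.card F : ℝ) with hq
  set N : ℝ := (Fintype.card E : ℝ) with hN
  have hNpos : 0 < N := by
    rw [hN]; exact_mod_cast Fintype.card_pos
  have hqpos : 0 < q := by
    rw [hq]; exact_mod_cast Fintype.card_pos
  have hk : (2 : ℝ) ≤ q - d := by
    have : ((d + 2 : ℕ) : ℝ) ≤ Fintype.card F := by exact_mod_cast hF
    push_cast at this
    linarith
  set B := ∑ x, ind (f x ≠ g x) with hB
  have hB0 : 0 ≤ B := sum_nonneg fun _ _ => ind_nonneg _
  let D (z : E × E) : ℝ := ∑ t : F, ind (f (z.1 + t • z.2) ≠ g (z.1 + t • z.2))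
  have hone (t : F) : ∑ z : E × E, ind (f (z.1 + t • z.2) ≠ g (z.1 + t • z.2)) = N * B := by
    have := sum_affine_fst (F := F) (fun k => ind (f k ≠ g k)) 0 (a := 1) (b := t) one_ne_zero
    simpa using this
  have htwo (t t' : F) : ∑ z : E × E, ind (f (z.1 + t • z.2) ≠ g (z.1 + t • z.2)) *
      ind (f (z.1 + t' • z.2) ≠ g (z.1 + t' • z.2)) ≤ (if t = t' then N * B else 0) + B ^ 2 := by
    split_ifs with ht
    · subst ht
      simp_rw [ind_mul_self]
      rw [hone]
      nlinarith
    · have := sum_affine (F := F) (fun k k' => ind (f k ≠ g k) * ind (f k' ≠ g k')) 0 0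
        (a := 1) (b := t) (c := 1) (e := t')
        (by simpa [sub_eq_zero] using fun h => ht (Eq.symm h))
      simp only [zero_add, one_smul] at this
      rw [this, Fintype.sum_prod_type, sq, hB, sum_mul_sum, zero_add]
  have hD : ∑ z, D z = q * (N * B) := by
    rw [sum_comm, sum_congr rfl fun t _ => hone t]
    simp [hq]
  have hD2 : ∑ z, D z ^ 2 ≤ q * (N * B) + q ^ 2 * B ^ 2 := by
    calc ∑ z, D z ^ 2 = ∑ t : F, ∑ t' : F, ∑ z : E × E,
          ind (f (z.1 + t • z.2) ≠ g (z.1 + t • z.2)) *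
            ind (f (z.1 + t' • z.2) ≠ g (z.1 + t' • z.2)) := by
          simp only [D, sq, sum_mul_sum]
          rw [sum_comm]
          exact sum_congr rfl fun t _ => sum_comm
      _ ≤ ∑ t : F, ∑ t' : F, ((if t = t' then N * B else 0) + B ^ 2) :=
          sum_le_sum fun t _ => sum_le_sum fun t' _ => htwo t t'
      _ = _ := by simp [sum_add_distrib, hq]; ring
  have hsum : 2 * (q - d) * (q * (N * B)) ≤
      3 * (q - d) * (δ * q * N ^ 2) + 8 * (q ^ 2 * B ^ 2) := by
    have h1 := sum_le_sum fun (z : E × E) (_ : z ∈ univ) =>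
      line_disagreement_le (f := f) hP hF (hg z.1 z.2)
    rw [← mul_sum, sum_add_distrib, ← mul_sum, ← mul_sum, sum_sub_distrib] at h1
    have h2 := mul_le_mul_of_nonneg_left hδ (by linarith : 0 ≤ 3 * (q - d))
    simp only [D] at hD hD2
    rw [← hq, hD] at h1
    linarith
  have h3 : 2 * (q - d) * N * B ≤ 3 * (q - d) * δ * N ^ 2 + 8 * q * B ^ 2 :=
    le_of_mul_le_mul_left (by linarith) hqpos
  have h4 : 2 * q ≤ (q - d) * (d + 2) := by
    nlinarith [mul_nonneg (Nat.cast_nonneg (α := ℝ) d) (sub_nonneg.mpr hk)]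
  have h5 : 16 * q * (d + 2) * δ ≤ (q - d) / 2 := by
    have h6 := mul_le_mul_of_nonneg_right h4 (by positivity : 0 ≤ 8 * ((d : ℝ) + 2) * δ)
    have h7 := mul_le_mul_of_nonneg_left hsmall (by linarith : 0 ≤ (q - d) / 2)
    linarith
  have h8 : 8 * q * B ^ 2 ≤ (q - d) / 2 * (N * B) := by
    have h9 := mul_le_mul_of_nonneg_left hcrude (by positivity : 0 ≤ 8 * q * B)
    have h10 := mul_le_mul_of_nonneg_right h5 (by positivity : 0 ≤ N * B)
    linarith
  have h11 : 0 < (q - d) * N := by nlinarith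
  refine le_of_mul_le_mul_left ?_ h11
  linarith

theorem exists_fits_of_test (hP : ∀ x h, (P x h).natDegree ≤ d) (hF : d + 2 ≤ Fintype.card F)
    (hδ : ∑ z : E × E, ∑ t, ind ((P z.1 z.2).eval t ≠ f (z.1 + t • z.2)) ≤
      δ * Fintype.card F * Fintype.card E ^ 2) (hδ0 : 0 ≤ δ)
    (hsmall : 1000 * ((d : ℝ) + 1) ^ 2 * δ ≤ 1) :
    ∃ g : E → F, ∑ x, ind (f x ≠ g x) ≤ 2 * δ * Fintype.card E ∧ ∀ x h, Fits d g univ x h := by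
  classical
  have hd : (0 : ℝ) ≤ d := Nat.cast_nonneg d
  have hδu (u : F) : ∑ z : E × E, ∑ r, ind (Disagrees P f z.1 z.2 r u) ≤
      δ * Fintype.card F * Fintype.card E ^ 2 := (sum_disagrees u).trans_le hδ
  obtain ⟨T, hTsub, hT⟩ := exists_subset_card_eq (s := (univ : Finset F).erase 0) (n := d + 1)
    (by rw [card_erase_of_mem (mem_univ _), card_univ]; omega)
  have hT0 : 0 ∉ T := fun h => notMem_erase _ _ (hTsub h)
  obtain ⟨w, hw⟩ := exists_forall_eval_zero (T := T)
  choose g hg using fun x => exists_majority hP hδu (by nlinarith) hT hT0 hw x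
  have hfits (x h : E) : Fits d g univ x h :=
    fits_univ_of_forall_card hF fun S hS =>
      fits_majority hP hδu hT hT0 hg (by nlinarith) hS x h
  have hcrude := sum_ne_majority_le_mul hP hδu hT hT0 hw (by nlinarith) hg
  exact ⟨g, sum_ne_le_two_mul hP hF hδ hδ0 hfits hcrude (by nlinarith), hfits⟩

end LowDegreeTest

/-- robustness lemma of GLRSW/RS: There is a constant `c > 0` such that
for any finite field `F` with `|F| ≥ d + 2`, any `0 ≤ δ ≤ 1/(c(d+1)²)`, any
`f : F^m → F` and any family `P` of univariate polynomials of degree at most `d`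
indexed by pairs `(x,h)`: if the fraction of triples `(x,h,t)` with
`P_{x,h}(t) ≠ f(x + t·h)` is at most `δ`, then there is `g : F^m → F` with
`d(f,g) ≤ 2δ` such that every restriction of `g` to a line agrees everywhere with a
univariate polynomial of degree at most `d`. -/
theorem robust_low_degree_test :
    ∃ c : ℝ, 0 < c ∧
    ∀ (F : Type) [Field F] [Fintype F] [DecidableEq F] (m d : ℕ), 1 ≤ m →
      d + 2 ≤ Fintype.card F →
      ∀ δ : ℝ, 0 ≤ δ → δ ≤ 1 / (c * ((d : ℝ) + 1) ^ 2) →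
      ∀ (f : (Fin m → F) → F)
        (P : (Fin m → F) → (Fin m → F) → Polynomial F),
        (∀ x h : Fin m → F, (P x h).natDegree ≤ d) →
        ((Finset.univ.filter fun z : (Fin m → F) × (Fin m → F) × F =>
            (P z.1 z.2.1).eval z.2.2 ≠ f (z.1 + z.2.2 • z.2.1)).card : ℝ) /
          (Fintype.card F : ℝ) ^ (2 * m + 1) ≤ δ →
      ∃ g : (Fin m → F) → F,
        ((Finset.univ.filter fun x : Fin m → F => f x ≠ g x).card : ℝ) /
          (Fintype.card F : ℝ) ^ m ≤ 2 * δ ∧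
        ∀ x h : Fin m → F, ∃ R : Polynomial F, R.natDegree ≤ d ∧
          ∀ t : F, R.eval t = g (x + t • h) := by
  refine ⟨1000, by norm_num, ?_⟩
  intro F _ _ _ m d _ hF δ hδ0 hδ f P hP hcount
  have hq : (0 : ℝ) < Fintype.card F := by exact_mod_cast Fintype.card_pos
  have hcard : (Fintype.card (Fin m → F) : ℝ) = (Fintype.card F : ℝ) ^ m := by simp
  have hsmall : 1000 * ((d : ℝ) + 1) ^ 2 * δ ≤ 1 := by
    rwa [le_div_iff₀ (by positivity), mul_comm] at hδ
  obtain ⟨g, hdist, hfits⟩ := exists_fits_of_test hP hF (f := f) (δ := δ) (by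
    rw [div_le_iff₀ (by positivity), ← sum_ind_eq_card Finset.univ
      fun z : (Fin m → F) × (Fin m → F) × F =>
        (P z.1 z.2.1).eval z.2.2 ≠ f (z.1 + z.2.2 • z.2.1)] at hcount
    simp only [Fintype.sum_prod_type] at hcount ⊢
    refine hcount.trans_eq ?_
    rw [hcard]; ring) hδ0 hsmall
  refine ⟨g, ?_, fun x h => ?_⟩
  · rw [sum_ind_eq_card] at hdist
    rwa [← hcard, div_le_iff₀ (by rw [hcard]; positivity)]
  · obtain ⟨R, hR, hRg⟩ := hfits x h
    exact ⟨R, hR, fun t => hRg t (Finset.mem_univ t)⟩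
end
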